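/- arXiv:2507.04254 — 3 statements merged into one kernel-verified Lean document; each statement's English description precedes it below -/
import Mathlib

section
/- Let k ≥ 3 be an odd integer. If G is a finite simple graph that contains no non-empty k-divisible subgraph, then G is (2q(k) − 2)-degenerate. -/
/-- A graph is `k`-divisible if every vertex has degree divisible by `k`. -/
def KDivisible {V : Type*} (k : ℕ) (H : SimpleGraph V) : Prop :=
  ∀ v : V, k ∣ {u : V | H.Adj v u}.ncard

/-- `G` contains no non-empty `k`-divisible subgraph. -/
def NoKDivisibleSubgraph {V : Type*} (k : ℕ) (G : SimpleGraph V) : Prop :=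
  ∀ H : SimpleGraph V, H ≤ G → KDivisible k H → H = ⊥

/-- `q m` is the smallest prime that is greater than or equal to `m`. -/
noncomputable def q (m : ℕ) : ℕ :=
  sInf {p : ℕ | p.Prime ∧ m ≤ p}

/-- A graph is `d`-degenerate if there is an ordering of its vertices in which every
vertex has at most `d` neighbours preceding it. -/
def Degenerate {V : Type*} (G : SimpleGraph V) (d : ℕ) : Prop :=
  ∃ o : V → ℕ, Function.Injective o ∧ ∀ v : V, {u : V | G.Adj v u ∧ o u < o v}.ncard ≤ d

theorem exists_isPerfectMatching_of_weight {N : Type*} [Fintype N] [DecidableEq N]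
    (Γ : SimpleGraph N) (hN : Even (Fintype.card N)) {r : ℕ} (hr : 0 < r) (w : N → N → ℕ)
    (hw : ∀ x y, w x y ≠ 0 → Γ.Adj x y) (hsum : ∀ y, ∑ x, w x y ≤ r) (C₁ C₂ : Set N)
    (hC₁ : Γ.IsClique C₁) (hC₂ : Γ.IsClique C₂)
    (hpos : ∀ Q : Finset N, Odd Q.card → 1 ≤ ∑ x ∈ Q, ∑ y ∈ Qᶜ, w x y)
    (hcut : ∀ Q : Finset N, Odd Q.card → (∀ x ∈ Q, x ∉ C₁) → (∀ x ∈ Q, x ∉ C₂) →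
      r ≤ ∑ x ∈ Q, ∑ y ∈ Qᶜ, w x y) :
    ∃ M : Γ.Subgraph, M.IsPerfectMatching := by
  classical
  rw [SimpleGraph.tutte]
  intro A hA
  unfold SimpleGraph.IsTutteViolator at hA
  have hpar := SimpleGraph.odd_ncard_oddComponents ((⊤ : Γ.Subgraph).deleteVerts A).coe
  have hverts : ((⊤ : Γ.Subgraph).deleteVerts A).verts = Aᶜ := by ext; simp
  have hcardv : Nat.card ((⊤ : Γ.Subgraph).deleteVerts A).verts = Aᶜ.ncard := by
    rw [Nat.card_coe_set_eq, hverts]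
  rw [hcardv] at hpar
  have hcompl := Set.ncard_add_ncard_compl A
  rw [Nat.card_eq_fintype_card] at hcompl
  set H := ((⊤ : Γ.Subgraph).deleteVerts A).coe with hH
  have hcard : A.ncard + 2 ≤ H.oddComponents.ncard := by
    grind
  clear hpar hA
  let Q : H.ConnectedComponent → Finset N := fun c =>
    Finset.univ.filter fun x => ∃ h, H.connectedComponentMk ⟨x, h⟩ = c
  have hQ : ∀ c x, x ∈ Q c ↔ ∃ h, H.connectedComponentMk ⟨x, h⟩ = c := by simp [Q]
  have hQcard : ∀ c, (Q c).card = c.supp.ncard := by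
    intro c
    rw [← Set.ncard_coe_finset, ← Set.ncard_image_of_injective c.supp Subtype.val_injective]
    congr 1
    ext x
    simp [hQ]
  have hQadj : ∀ c c' x y, x ∈ Q c → y ∈ Q c' → Γ.Adj x y → c = c' := by
    intro c c' x y hx hy hxy
    obtain ⟨h, rfl⟩ := (hQ _ _).1 hx
    obtain ⟨h', rfl⟩ := (hQ _ _).1 hy
    rw [SimpleGraph.ConnectedComponent.eq]
    apply SimpleGraph.Adj.reachable
    rw [hH, SimpleGraph.Subgraph.coe_adj, SimpleGraph.Subgraph.deleteVerts_adj]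
    rw [hverts] at h h'
    exact ⟨trivial, h, trivial, h', hxy⟩
  have hQout : ∀ c x y, x ∈ Q c → y ∉ Q c → w x y ≠ 0 → y ∈ A := by
    intro c x y hx hy hxy
    by_contra hyA
    have hy' : y ∈ ((⊤ : Γ.Subgraph).deleteVerts A).verts := by rw [hverts]; exact hyA
    have := hQadj c _ x y hx ((hQ _ _).2 ⟨hy', rfl⟩) (hw _ _ hxy)
    exact hy ((hQ _ _).2 ⟨hy', this.symm⟩)
  have hQdisj : ∀ c c', c ≠ c' → Disjoint (Q c) (Q c') := by
    intro c c' hcc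
    rw [Finset.disjoint_left]
    intro x hx hx'
    obtain ⟨h, rfl⟩ := (hQ _ _).1 hx
    obtain ⟨h', rfl⟩ := (hQ _ _).1 hx'
    exact hcc rfl
  let O : Finset H.ConnectedComponent := Finset.univ.filter fun c => Odd c.supp.ncard
  have hO : O.card = H.oddComponents.ncard := by
    rw [← Set.ncard_coe_finset]; simp [O]
  let f : H.ConnectedComponent → ℕ := fun c => ∑ x ∈ Q c, ∑ y ∈ (Q c)ᶜ, w x y
  let AF : Finset N := Finset.univ.filter (· ∈ A)
  have hAF : AF.card = A.ncard := by
    rw [← Set.ncard_coe_finset]; simp [AF]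
  have hupper : ∑ c ∈ O, f c ≤ r * A.ncard := by
    calc ∑ c ∈ O, f c ≤ ∑ c ∈ O, ∑ x ∈ Q c, ∑ y ∈ AF, w x y := by
          refine Finset.sum_le_sum fun c _ => Finset.sum_le_sum fun x hx => ?_
          refine Finset.sum_le_sum_of_ne_zero fun y hy hy0 => ?_
          simpa [AF] using hQout c x y hx (by simpa using hy) hy0
      _ = ∑ x ∈ O.biUnion Q, ∑ y ∈ AF, w x y := by
          rw [Finset.sum_biUnion]
          exact fun c _ c' _ h => hQdisj c c' h
      _ ≤ ∑ x, ∑ y ∈ AF, w x y := Finset.sum_le_sum_of_subset (Finset.subset_univ _)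
      _ = ∑ y ∈ AF, ∑ x, w x y := Finset.sum_comm
      _ ≤ ∑ y ∈ AF, r := Finset.sum_le_sum fun y _ => hsum y
      _ = r * A.ncard := by rw [Finset.sum_const, hAF, smul_eq_mul, mul_comm]
  have hmeet : ∀ C : Set N, Γ.IsClique C → (O.filter fun c => ∃ x ∈ Q c, x ∈ C).card ≤ 1 := by
    intro C hC
    rw [Finset.card_le_one]
    intro c hc c' hc'
    obtain ⟨x, hx, hxC⟩ := (Finset.mem_filter.1 hc).2
    obtain ⟨y, hy, hyC⟩ := (Finset.mem_filter.1 hc').2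
    by_cases hxy : x = y
    · subst hxy
      by_contra hcc
      exact Finset.disjoint_left.1 (hQdisj c c' hcc) hx hy
    · exact hQadj c c' x y hx hy (hC hxC hyC hxy)
  set B := (O.filter fun c => ∃ x ∈ Q c, x ∈ C₁) ∪ (O.filter fun c => ∃ x ∈ Q c, x ∈ C₂) with hB
  have hBO : B ⊆ O := Finset.union_subset (Finset.filter_subset _ _) (Finset.filter_subset _ _)
  have hB2 : B.card ≤ 2 :=
    (Finset.card_union_le _ _).trans (add_le_add (hmeet C₁ hC₁) (hmeet C₂ hC₂))
  have hodd : ∀ c ∈ O, Odd (Q c).card := by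
    intro c hc
    rw [hQcard]
    exact (Finset.mem_filter.1 hc).2
  have hlowB : B.card ≤ ∑ c ∈ B, f c := by
    rw [Finset.card_eq_sum_ones]
    exact Finset.sum_le_sum fun c hc => hpos _ (hodd c (hBO hc))
  have hlowO : r * (O \ B).card ≤ ∑ c ∈ O \ B, f c := by
    rw [mul_comm, ← smul_eq_mul, ← Finset.sum_const]
    refine Finset.sum_le_sum fun c hc => ?_
    obtain ⟨hcO, hcB⟩ := Finset.mem_sdiff.1 hc
    refine hcut _ (hodd c hcO) ?_ ?_ <;> intro x hx hxC <;> apply hcB <;> rw [hB, Finset.mem_union]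
    · exact Or.inl (Finset.mem_filter.2 ⟨hcO, x, hx, hxC⟩)
    · exact Or.inr (Finset.mem_filter.2 ⟨hcO, x, hx, hxC⟩)
  have hsplit := Finset.sum_sdiff (f := f) hBO
  have hcsplit := Finset.card_sdiff_add_card_eq_card hBO
  obtain ⟨r, rfl⟩ := Nat.exists_eq_add_of_lt hr
  nlinarith

theorem exists_involution_of_weight {N : Type*} [DecidableEq N] (U : Finset N)
    (Γ : SimpleGraph N) (hU : Even U.card) {r : ℕ} (hr : 0 < r) (w : N → N → ℕ)
    (hw : ∀ x ∈ U, ∀ y ∈ U, w x y ≠ 0 → Γ.Adj x y) (hsum : ∀ y ∈ U, ∑ x ∈ U, w x y ≤ r)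
    (C₁ C₂ : Set N) (hC₁ : Γ.IsClique C₁) (hC₂ : Γ.IsClique C₂)
    (hpos : ∀ Q ⊆ U, Odd Q.card → 1 ≤ ∑ x ∈ Q, ∑ y ∈ U \ Q, w x y)
    (hcut : ∀ Q ⊆ U, Odd Q.card → (∀ x ∈ Q, x ∉ C₁) → (∀ x ∈ Q, x ∉ C₂) →
      r ≤ ∑ x ∈ Q, ∑ y ∈ U \ Q, w x y) :
    ∃ f : N → N, ∀ x ∈ U, f x ∈ U ∧ Γ.Adj x (f x) ∧ f (f x) = x := by
  classical
  let e : U ↪ N := Function.Embedding.subtype _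
  have hmap : ∀ Q : Finset U, Q.map e ⊆ U := by
    intro Q x hx
    obtain ⟨y, -, rfl⟩ := Finset.mem_map.1 hx
    exact y.2
  have hcompl : ∀ Q : Finset U, U \ Q.map e = Qᶜ.map e := by
    intro Q
    ext x
    simp [e]
    tauto
  have hsums : ∀ Q : Finset U, ∑ x ∈ Q, ∑ y ∈ Qᶜ, w x y =
      ∑ x ∈ Q.map e, ∑ y ∈ U \ Q.map e, w x y := by
    intro Q
    rw [hcompl, Finset.sum_map]
    refine Finset.sum_congr rfl fun x _ => ?_
    rw [Finset.sum_map]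
    rfl
  obtain ⟨M, hM⟩ := exists_isPerfectMatching_of_weight (Γ.comap e) (by simpa using hU) hr
    (fun x y => w x y) (fun x y h => hw x x.2 y y.2 h)
    (fun y => by
      have := hsum y y.2
      rwa [← Finset.sum_coe_sort U (fun x => w x y)] at this)
    (e ⁻¹' C₁) (e ⁻¹' C₂)
    (fun x hx y hy hxy => hC₁ hx hy (fun h => hxy (e.injective h)))
    (fun x hx y hy hxy => hC₂ hx hy (fun h => hxy (e.injective h)))
    (fun Q hQ => by
      rw [hsums]; exact hpos _ (hmap Q) (by simpa using hQ))
    (fun Q hQ h1 h2 => by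
      rw [hsums]
      refine hcut _ (hmap Q) (by simpa using hQ) ?_ ?_ <;> intro x hx <;>
        obtain ⟨y, hy, rfl⟩ := Finset.mem_map.1 hx
      exacts [h1 y hy, h2 y hy])
  rw [SimpleGraph.Subgraph.isPerfectMatching_iff] at hM
  choose g hg hgu using hM
  refine ⟨fun x => if h : x ∈ U then g ⟨x, h⟩ else x, fun x hx => ?_⟩
  have hgU : (g ⟨x, hx⟩ : N) ∈ U := (g ⟨x, hx⟩).2
  simp only [hx, hgU, dite_true, true_and]
  exact ⟨(hg ⟨x, hx⟩).adj_sub, congrArg Subtype.val (hgu _ _ (hg ⟨x, hx⟩).symm).symm⟩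

section Gadget

variable {V : Type*} [Fintype V] [DecidableEq V] (G : SimpleGraph V) [DecidableRel G.Adj]
  (X : Finset V) (m : ℕ)

/-- The vertices of the gadget graph over `X`: a slot `(v, u)` for every edge `vu` with `v ∈ X`,
and `m` inner vertices for every `v ∈ X`. -/
def gadgetVerts : Finset ((V × V) ⊕ (V × Fin m)) :=
  (Finset.univ.filter fun d : V × V => d.1 ∈ X ∧ G.Adj d.1 d.2).disjSum (X ×ˢ Finset.univ)

/-- The edges of the gadget graph: slots and inner vertices at the same vertex are adjacent, the
two slots of an edge are adjacent, and the free slots form a clique. -/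
def gadgetGraph (free : V → V → Prop) : SimpleGraph ((V × V) ⊕ (V × Fin m)) :=
  SimpleGraph.fromRel fun
    | .inl d, .inl d' => (d'.1 = d.2 ∧ d'.2 = d.1) ∨ (free d.1 d.2 ∧ free d'.1 d'.2)
    | .inl d, .inr i => d.1 = i.1
    | _, _ => False

/-- The weight of an edge of the gadget graph. -/
def gadgetWeight : (V × V) ⊕ (V × Fin m) → (V × V) ⊕ (V × Fin m) → ℕ
  | .inl d, .inl d' => if d'.1 = d.2 ∧ d'.2 = d.1 then 2 else 0
  | .inl d, .inr i => if d.1 = i.1 then 1 else 0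
  | .inr i, .inl d => if d.1 = i.1 then 1 else 0
  | .inr _, .inr _ => 0

variable {G X m}

@[simp] theorem inl_mem_gadgetVerts {v u : V} :
    Sum.inl (v, u) ∈ gadgetVerts G X m ↔ v ∈ X ∧ G.Adj v u := by
  simp [gadgetVerts]

@[simp] theorem inr_mem_gadgetVerts {v : V} {j : Fin m} :
    Sum.inr (v, j) ∈ gadgetVerts G X m ↔ v ∈ X := by
  simp [gadgetVerts]

theorem card_filter_slots {r : ℕ} (hdeg : ∀ v ∈ X, G.degree v = r) :
    (Finset.univ.filter fun d : V × V => d.1 ∈ X ∧ G.Adj d.1 d.2).card = X.card * r := by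
  have h : (Finset.univ.filter fun d : V × V => d.1 ∈ X ∧ G.Adj d.1 d.2) =
      (X.sigma fun v => G.neighborFinset v).map (Equiv.sigmaEquivProd V V).toEmbedding := by
    ext ⟨a, b⟩
    simp
  rw [h, Finset.card_map, Finset.card_sigma, Finset.sum_congr rfl
    (fun v hv => (G.card_neighborFinset_eq_degree v).trans (hdeg v hv)), Finset.sum_const,
    smul_eq_mul]

theorem card_gadgetVerts (hdeg : ∀ v ∈ X, G.degree v = m + 2) :
    (gadgetVerts G X m).card = X.card * (2 * m + 2) := by
  rw [gadgetVerts, Finset.card_disjSum, card_filter_slots hdeg]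
  simp
  ring

theorem sum_gadgetWeight_le (hdeg : ∀ v ∈ X, G.degree v = m + 2)
    (y : (V × V) ⊕ (V × Fin m)) (hy : y ∈ gadgetVerts G X m) :
    ∑ x ∈ gadgetVerts G X m, gadgetWeight m x y ≤ m + 2 := by
  rw [gadgetVerts, Finset.sum_disjSum]
  rcases y with ⟨v, u⟩ | ⟨v, j⟩
  · have h1 : ∑ x ∈ Finset.univ.filter (fun d : V × V => d.1 ∈ X ∧ G.Adj d.1 d.2),
        gadgetWeight m (.inl x) (.inl (v, u)) ≤ 2 := by
      calc _ ≤ ∑ x ∈ {(u, v)}, gadgetWeight m (.inl x) (.inl (v, u)) := by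
            refine Finset.sum_le_sum_of_ne_zero fun x _ hx => ?_
            simp [gadgetWeight] at hx
            simp [hx]
        _ ≤ 2 := by simp [gadgetWeight]
    have h2 : ∑ x ∈ X ×ˢ (Finset.univ : Finset (Fin m)),
        gadgetWeight m (.inr x) (.inl (v, u)) ≤ m := by
      calc _ ≤ ∑ x ∈ {v} ×ˢ (Finset.univ : Finset (Fin m)), 1 := by
            refine (Finset.sum_le_sum (g := fun x => if v = x.1 then 1 else 0) fun x _ => ?_).trans
              ?_
            · simp [gadgetWeight]
            · rw [← Finset.sum_filter]
              refine Finset.sum_le_sum_of_subset fun x hx => ?_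
              simp at hx ⊢
              exact ⟨x.2, by rw [hx.2]⟩
        _ = m := by simp
    omega
  · have hv : v ∈ X := by simpa using hy
    have h2 : ∑ x ∈ X ×ˢ (Finset.univ : Finset (Fin m)),
        gadgetWeight m (.inr x) (.inr (v, j)) = 0 := by simp [gadgetWeight]
    rw [h2, add_zero, ← hdeg v hv, ← G.card_neighborFinset_eq_degree]
    calc _ = ∑ x ∈ Finset.univ.filter (fun d : V × V => d.1 ∈ X ∧ G.Adj d.1 d.2),
          if x.1 = v then 1 else 0 := by simp [gadgetWeight]
      _ = ((Finset.univ.filter (fun d : V × V => d.1 ∈ X ∧ G.Adj d.1 d.2)).filter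
          fun x => x.1 = v).card := by rw [Finset.card_filter]
      _ ≤ ((G.neighborFinset v).image fun u => (v, u)).card := by
          refine Finset.card_le_card fun x hx => ?_
          simp at hx ⊢
          obtain ⟨⟨-, h⟩, rfl⟩ := hx
          exact ⟨x.2, h, rfl⟩
      _ ≤ _ := Finset.card_image_le

theorem adj_of_gadgetWeight_ne_zero {free : V → V → Prop} (x y : (V × V) ⊕ (V × Fin m))
    (hx : x ∈ gadgetVerts G X m) (h : gadgetWeight m x y ≠ 0) :
    (gadgetGraph m free).Adj x y := by
  rcases x with ⟨v, u⟩ | ⟨v, j⟩ <;> rcases y with ⟨v', u'⟩ | ⟨v', j'⟩ <;>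
    simp [gadgetWeight, gadgetGraph] at h hx ⊢
  · obtain ⟨rfl, rfl⟩ := h
    exact ⟨fun h => absurd h hx.2.ne, Or.inl (Or.inl ⟨rfl, rfl⟩)⟩
  · exact h
  · exact h

/-- The slots at `v` lying in `Q`. -/
def slotsAt (Q : Finset ((V × V) ⊕ (V × Fin m))) (v : V) : Finset V :=
  Finset.univ.filter fun u => Sum.inl (v, u) ∈ Q

/-- The inner vertices at `v` lying in `Q`. -/
def innersAt (Q : Finset ((V × V) ⊕ (V × Fin m))) (v : V) : Finset (Fin m) :=
  Finset.univ.filter fun j => Sum.inr (v, j) ∈ Q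

@[simp] theorem mem_slotsAt {Q : Finset ((V × V) ⊕ (V × Fin m))} {v u : V} :
    u ∈ slotsAt Q v ↔ Sum.inl (v, u) ∈ Q := by simp [slotsAt]

@[simp] theorem mem_innersAt {Q : Finset ((V × V) ⊕ (V × Fin m))} {v : V} {j : Fin m} :
    j ∈ innersAt Q v ↔ Sum.inr (v, j) ∈ Q := by simp [innersAt]

theorem card_eq_sum_slotsAt_add_innersAt {Q : Finset ((V × V) ⊕ (V × Fin m))}
    (hQ : Q ⊆ gadgetVerts G X m) :
    Q.card = ∑ v ∈ X, ((slotsAt Q v).card + (innersAt Q v).card) := by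
  have hmap : ∀ x ∈ Q, Sum.elim Prod.fst Prod.fst x ∈ X := by
    intro x hx
    have := hQ hx
    rcases x with ⟨v, u⟩ | ⟨v, j⟩ <;> simp at this ⊢ <;> tauto
  rw [Finset.card_eq_sum_card_fiberwise hmap]
  refine Finset.sum_congr rfl fun v _ => ?_
  rw [← Finset.card_disjSum, ← Finset.card_map
    ((Function.Embedding.sectR v V).sumMap (Function.Embedding.sectR v (Fin m)))]
  congr 1
  ext x
  rcases x with ⟨v', u⟩ | ⟨v', j⟩ <;> simp <;> grind

/-- The pairs leaving `Q` inside the gadget of `v`. -/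
def pairsAt (U Q : Finset ((V × V) ⊕ (V × Fin m))) (v : V) :
    Finset (((V × V) ⊕ (V × Fin m)) × ((V × V) ⊕ (V × Fin m))) :=
  (Q ×ˢ (U \ Q)).filter fun p =>
    Sum.elim Prod.fst Prod.fst p.1 = v ∧ Sum.elim Prod.fst Prod.fst p.2 = v

theorem le_sum_pairsAt {Q : Finset ((V × V) ⊕ (V × Fin m))}
    {v : V} (hv : v ∈ X) :
    (slotsAt Q v).card * (m - (innersAt Q v).card) +
      (innersAt Q v).card * (G.neighborFinset v \ slotsAt Q v).card ≤
      ∑ p ∈ pairsAt (gadgetVerts G X m) Q v, gadgetWeight m p.1 p.2 := by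
  let f : (V × Fin m) ⊕ (Fin m × V) → ((V × V) ⊕ (V × Fin m)) × ((V × V) ⊕ (V × Fin m)) :=
    Sum.elim (fun d => (.inl (v, d.1), .inr (v, d.2))) (fun d => (.inr (v, d.1), .inl (v, d.2)))
  have hf : Function.Injective f := by
    rintro (⟨a, b⟩ | ⟨a, b⟩) (⟨c, d⟩ | ⟨c, d⟩) h <;> simp [f] at h <;> simp [h]
  have hTc : (innersAt Q v)ᶜ.card = m - (innersAt Q v).card := by
    rw [Finset.card_compl, Fintype.card_fin]
  rw [← hTc, ← Finset.card_product, ← Finset.card_product, ← Finset.card_disjSum,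
    ← Finset.card_map ⟨f, hf⟩, Finset.card_eq_sum_ones]
  calc _ ≤ ∑ p ∈ Finset.map ⟨f, hf⟩ _, gadgetWeight m p.1 p.2 := by
        refine Finset.sum_le_sum fun p hp => ?_
        obtain ⟨x, hx, rfl⟩ := Finset.mem_map.1 hp
        rcases x with ⟨a, b⟩ | ⟨a, b⟩ <;> simp [f, gadgetWeight]
    _ ≤ _ := by
        refine Finset.sum_le_sum_of_subset fun p hp => ?_
        obtain ⟨x, hx, rfl⟩ := Finset.mem_map.1 hp
        rcases x with ⟨a, b⟩ | ⟨a, b⟩ <;> simp [f, pairsAt, hv] at hx ⊢ <;> exact hx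

theorem gadget_cut_arith {m a b : ℕ} (hm : 3 ≤ m) (ha : a ≤ m + 2) (hb : b ≤ m)
    (h0 : ¬ (a = 0 ∧ b = 0)) (h1 : ¬ (a = m + 2 ∧ b = m)) :
    m ≤ a * (m - b) + b * (m + 2 - a) ∧
      (m + 2 ≤ a * (m - b) + b * (m + 2 - a) ∨ (a = 1 ∧ b = 0) ∨ (a = m + 1 ∧ b = m)) := by
  obtain ⟨c, rfl⟩ := Nat.exists_eq_add_of_le hb
  obtain ⟨d, hd⟩ := Nat.exists_eq_add_of_le ha
  have e1 : b + c - b = c := by omega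
  have e2 : b + c + 2 - a = d := by omega
  rw [e1, e2]
  rcases Nat.eq_zero_or_pos b with rfl | hb'
  · rcases Nat.lt_or_ge a 2 with h | h
    · have : a = 1 := by omega
      subst this
      simp
    · have : c + c ≤ a * c := by nlinarith
      constructor
      · nlinarith
      · left; nlinarith
  · rcases Nat.eq_zero_or_pos c with rfl | hc'
    · rcases Nat.lt_or_ge d 2 with h | h
      · have : d = 1 := by
          by_contra h'
          exact h1 ⟨by omega, rfl⟩
        subst this
        refine ⟨by simp, Or.inr (Or.inr ⟨by omega, rfl⟩)⟩
      · have : b + b ≤ b * d := by nlinarith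
        constructor
        · nlinarith
        · left; nlinarith
    · have h1 : a ≤ a * c := Nat.le_mul_of_pos_right a hc'
      have h2 : d ≤ b * d := Nat.le_mul_of_pos_left d hb'
      constructor
      · omega
      · left; omega

theorem exists_partial_gadget {Q : Finset ((V × V) ⊕ (V × Fin m))}
    (hdeg : ∀ v ∈ X, G.degree v = m + 2) (hQ : Q ⊆ gadgetVerts G X m) (hodd : Odd Q.card) :
    ∃ v ∈ X, ¬ (slotsAt Q v = ∅ ∧ innersAt Q v = ∅) ∧
      ¬ (slotsAt Q v = G.neighborFinset v ∧ innersAt Q v = Finset.univ) := by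
  rw [card_eq_sum_slotsAt_add_innersAt hQ] at hodd
  by_contra! h
  refine Nat.not_odd_iff_even.2 (Finset.even_sum _ fun v hv => ?_) hodd
  by_cases h0 : slotsAt Q v = ∅ ∧ innersAt Q v = ∅
  · simp [h0.1, h0.2]
  · obtain ⟨h1, h2⟩ := h v hv (fun h1 => Finset.nonempty_iff_ne_empty.2 fun h2 => h0 ⟨h1, h2⟩)
    rw [h1, h2, G.card_neighborFinset_eq_degree, hdeg v hv, Finset.card_univ, Fintype.card_fin]
    exact ⟨m + 1, by ring⟩

theorem slotsAt_subset {Q : Finset ((V × V) ⊕ (V × Fin m))} (hQ : Q ⊆ gadgetVerts G X m) (v : V) :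
    slotsAt Q v ⊆ G.neighborFinset v := by
  intro u hu
  have := hQ (mem_slotsAt.1 hu)
  simp at this ⊢
  exact this.2

theorem sum_pairsAt_of_partial {Q : Finset ((V × V) ⊕ (V × Fin m))} (hm : 3 ≤ m)
    (hdeg : ∀ v ∈ X, G.degree v = m + 2) (hQ : Q ⊆ gadgetVerts G X m) {v : V} (hv : v ∈ X)
    (h0 : ¬ (slotsAt Q v = ∅ ∧ innersAt Q v = ∅))
    (h1 : ¬ (slotsAt Q v = G.neighborFinset v ∧ innersAt Q v = Finset.univ)) :
    m ≤ ∑ p ∈ pairsAt (gadgetVerts G X m) Q v, gadgetWeight m p.1 p.2 ∧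
      (m + 2 ≤ ∑ p ∈ pairsAt (gadgetVerts G X m) Q v, gadgetWeight m p.1 p.2 ∨
        ((∃ u, slotsAt Q v = {u}) ∧ innersAt Q v = ∅) ∨
        ((∃ u, G.neighborFinset v \ slotsAt Q v = {u}) ∧ innersAt Q v = Finset.univ)) := by
  have hle := le_sum_pairsAt (G := G) (m := m) (Q := Q) hv
  have hS := slotsAt_subset hQ v
  have hN : (G.neighborFinset v).card = m + 2 :=
    (G.card_neighborFinset_eq_degree v).trans (hdeg v hv)
  have hScard := Finset.card_le_card hS
  rw [Finset.card_sdiff_of_subset hS, hN] at hle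
  have hT : (innersAt Q v).card ≤ m := by simpa using Finset.card_le_univ (innersAt Q v)
  have huniv : (innersAt Q v).card = m → innersAt Q v = Finset.univ := by
    intro h
    rw [← Finset.card_eq_iff_eq_univ, h, Fintype.card_fin]
  obtain ⟨ha, hb⟩ := gadget_cut_arith hm (hN ▸ hScard) hT
    (fun h => h0 ⟨Finset.card_eq_zero.1 h.1, Finset.card_eq_zero.1 h.2⟩)
    (fun h => h1 ⟨Finset.eq_of_subset_of_card_le hS (by omega), huniv h.2⟩)
  refine ⟨ha.trans hle, ?_⟩
  rcases hb with hb | hb | hb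
  · exact Or.inl (hb.trans hle)
  · exact Or.inr (Or.inl ⟨Finset.card_eq_one.1 hb.1, Finset.card_eq_zero.1 hb.2⟩)
  · refine Or.inr (Or.inr ⟨Finset.card_eq_one.1 ?_, huniv hb.2⟩)
    rw [Finset.card_sdiff_of_subset hS]
    omega

theorem le_gadget_cut {Q : Finset ((V × V) ⊕ (V × Fin m))} (hm : 3 ≤ m)
    (hdeg : ∀ v ∈ X, G.degree v = m + 2) (v₀ : V) (j₀ : Fin m)
    (hcut : ∀ Y ⊆ X, Y.Nonempty → v₀ ∉ Y →
      2 ≤ ((Y ×ˢ (X \ Y)).filter fun d => G.Adj d.1 d.2).card)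
    (hQ : Q ⊆ gadgetVerts G X m) (hodd : Odd Q.card)
    (hfree : ∀ v u, Sum.inl (v, u) ∈ Q → u ∈ X) (hinner : Sum.inr (v₀, j₀) ∉ Q) :
    m + 2 ≤ ∑ x ∈ Q, ∑ y ∈ gadgetVerts G X m \ Q, gadgetWeight m x y := by
  set U := gadgetVerts G X m with hU
  rw [← Finset.sum_product']
  obtain ⟨v, hv, hv0, hv1⟩ := exists_partial_gadget hdeg hQ hodd
  obtain ⟨hge, hcase⟩ := sum_pairsAt_of_partial hm hdeg hQ hv hv0 hv1
  rw [← hU] at hge hcase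
  have hsub : ∀ v, pairsAt U Q v ⊆ Q ×ˢ (U \ Q) := fun v => Finset.filter_subset _ _
  by_cases hother : ∃ v' ∈ X, v' ≠ v ∧ ¬ (slotsAt Q v' = ∅ ∧ innersAt Q v' = ∅) ∧
      ¬ (slotsAt Q v' = G.neighborFinset v' ∧ innersAt Q v' = Finset.univ)
  · obtain ⟨v', hv', hne, hv0', hv1'⟩ := hother
    have hge' := (sum_pairsAt_of_partial hm hdeg hQ hv' hv0' hv1').1
    rw [← hU] at hge'
    have hdisj : Disjoint (pairsAt U Q v) (pairsAt U Q v') := by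
      rw [Finset.disjoint_left]
      intro p hp hp'
      exact hne ((Finset.mem_filter.1 hp').2.1.symm.trans (Finset.mem_filter.1 hp).2.1)
    have := Finset.sum_le_sum_of_subset (f := fun p => gadgetWeight m p.1 p.2)
      (Finset.union_subset (hsub v) (hsub v'))
    rw [Finset.sum_union hdisj] at this
    omega
  have hfull : ∀ v' ∈ X, v' ≠ v → (slotsAt Q v' = ∅ ∧ innersAt Q v' = ∅) ∨
      (slotsAt Q v' = G.neighborFinset v' ∧ innersAt Q v' = Finset.univ) := by
    intro v' hv' hne
    by_contra h
    exact hother ⟨v', hv', hne, fun h' => h (Or.inl h'), fun h' => h (Or.inr h')⟩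
  have hcross : ∀ a b, Sum.inl (a, b) ∈ Q → Sum.inl (b, a) ∉ Q →
      m + 2 ≤ ∑ p ∈ Q ×ˢ (U \ Q), gadgetWeight m p.1 p.2 := by
    intro a b hab hba
    have habU := inl_mem_gadgetVerts.1 (hQ hab)
    have hmem : ((Sum.inl (a, b), Sum.inl (b, a)) :
        ((V × V) ⊕ (V × Fin m)) × ((V × V) ⊕ (V × Fin m))) ∈ Q ×ˢ (U \ Q) := by
      simp [hab, hba, hU, habU.2.symm, hfree a b hab]
    have hnot : ((Sum.inl (a, b), Sum.inl (b, a)) :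
        ((V × V) ⊕ (V × Fin m)) × ((V × V) ⊕ (V × Fin m))) ∉ pairsAt U Q v := by
      intro h
      have := (Finset.mem_filter.1 h).2
      simp at this
      exact habU.2.ne (this.1.trans this.2.symm)
    have := Finset.sum_le_sum_of_subset (f := fun p => gadgetWeight m p.1 p.2)
      (Finset.insert_subset hmem (hsub v))
    rw [Finset.sum_insert hnot] at this
    have h2 : gadgetWeight m (Sum.inl (a, b)) (Sum.inl (b, a)) = 2 := by simp [gadgetWeight]
    simp only [h2] at this
    omega
  let Y := X.filter fun v' => slotsAt Q v' = G.neighborFinset v' ∧ innersAt Q v' = Finset.univ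
  have hv₀Y : v₀ ∉ Y := by
    intro h
    have : j₀ ∈ innersAt Q v₀ := by rw [(Finset.mem_filter.1 h).2.2]; simp
    exact hinner (mem_innersAt.1 this)
  have hempty : ∀ x ∈ X, x ∉ Y → x ≠ v → ∀ y, Sum.inl (x, y) ∉ Q := by
    intro x hx hxY hxv y hy
    rcases hfull x hx hxv with h | h
    · have : y ∈ slotsAt Q x := mem_slotsAt.2 hy
      rw [h.1] at this
      simp at this
    · exact hxY (Finset.mem_filter.2 ⟨hx, h⟩)
  have hY : ∀ y ∈ Y, ∀ x, G.Adj y x → Sum.inl (y, x) ∈ Q := by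
    intro y hy x hyx
    rw [← mem_slotsAt, (Finset.mem_filter.1 hy).2.1]
    simpa using hyx
  have hvY : v ∉ Y := fun h => hv1 (Finset.mem_filter.1 h).2
  have hpick : ∀ Z ⊆ X, Z.Nonempty → v₀ ∉ Z → ∀ d : V × V,
      ∃ z ∈ Z, ∃ x ∈ X, x ∉ Z ∧ G.Adj z x ∧ (z, x) ≠ d := by
    intro Z hZ hne h₀ d
    obtain ⟨⟨z, x⟩, hzx, hd⟩ := Finset.exists_mem_ne (hcut Z hZ hne h₀) d
    simp at hzx
    exact ⟨z, hzx.1.1, x, hzx.1.2.1, hzx.1.2.2, hzx.2, hd⟩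
  rcases hcase with hcase | ⟨⟨u, hu⟩, hT⟩ | ⟨⟨u, hu⟩, hT⟩
  · exact hcase.trans (Finset.sum_le_sum_of_subset (hsub v))
  · have huQ : Sum.inl (v, u) ∈ Q := by rw [← mem_slotsAt, hu]; simp
    have huX := hfree v u huQ
    have huv : u ≠ v := (inl_mem_gadgetVerts.1 (hQ huQ)).2.ne'
    by_cases hYne : Y.Nonempty
    · obtain ⟨y, hy, x, hx, hxY, hyx, hne⟩ := hpick Y (Finset.filter_subset _ _) hYne hv₀Y (u, v)
      refine hcross y x (hY y hy x hyx) fun h => ?_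
      by_cases hxv : x = v
      · subst hxv
        have : y ∈ slotsAt Q x := mem_slotsAt.2 h
        rw [hu, Finset.mem_singleton] at this
        exact hne (by rw [this])
      · exact hempty x hx hxY hxv y h
    · exact hcross v u huQ (hempty u huX (fun h => hYne ⟨u, h⟩) huv v)
  · have hvv₀ : v ≠ v₀ := by
      rintro rfl
      have : j₀ ∈ innersAt Q v := by rw [hT]; simp
      exact hinner (mem_innersAt.1 this)
    obtain ⟨z, hz, x, hx, hxZ, hzx, hne⟩ := hpick (insert v Y)
      (Finset.insert_subset hv (Finset.filter_subset _ _)) (Finset.insert_nonempty _ _)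
      (by simp [hvv₀.symm, hv₀Y]) (v, u)
    simp only [Finset.mem_insert, not_or] at hz hxZ
    refine hcross z x ?_ (hempty x hx hxZ.2 hxZ.1 z)
    rcases hz with rfl | hz
    · by_contra h
      have : x ∈ G.neighborFinset z \ slotsAt Q z := by simp [hzx, h]
      rw [hu, Finset.mem_singleton] at this
      exact hne (by rw [this])
    · exact hY z hz x hzx

theorem exists_regularOn_of_two_le_cut (hm : 3 ≤ m) (hdeg : ∀ v ∈ X, G.degree v = m + 2)
    (v₀ : V) (hv₀ : v₀ ∈ X) (w₀ : V)
    (hcut : ∀ Y ⊆ X, Y.Nonempty → v₀ ∉ Y →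
      2 ≤ ((Y ×ˢ (X \ Y)).filter fun d => G.Adj d.1 d.2).card) :
    ∃ F ≤ G, (∀ v ∈ X, {u | F.Adj v u}.ncard = m) ∧
      (w₀ ∉ X → G.Adj v₀ w₀ → F.Adj v₀ w₀) := by
  let free : V → V → Prop := fun v u => u ∉ X ∧ ¬ (v = v₀ ∧ u = w₀)
  let j₀ : Fin m := ⟨0, by omega⟩
  obtain ⟨f, hf⟩ := exists_involution_of_weight (gadgetVerts G X m) (gadgetGraph m free)
    (by rw [card_gadgetVerts hdeg]; exact ⟨X.card * (m + 1), by ring⟩) (r := m + 2) (by omega)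
    (gadgetWeight m) (fun x hx y _ h => adj_of_gadgetWeight_ne_zero x y hx h)
    (sum_gadgetWeight_le hdeg)
    {x | ∃ v u, x = Sum.inl (v, u) ∧ free v u} {Sum.inl (v₀, w₀), Sum.inr (v₀, j₀)}
    (by
      rintro _ ⟨v, u, rfl, h⟩ _ ⟨v', u', rfl, h'⟩ hne
      exact (SimpleGraph.fromRel_adj _ _ _).2 ⟨hne, Or.inl (Or.inr ⟨h, h'⟩)⟩)
    (by
      rintro _ (rfl | rfl) _ (rfl | rfl) hne
      · exact absurd rfl hne
      · exact (SimpleGraph.fromRel_adj _ _ _).2 ⟨hne, Or.inl rfl⟩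
      · exact (SimpleGraph.fromRel_adj _ _ _).2 ⟨hne, Or.inr rfl⟩
      · exact absurd rfl hne)
    (by
      intro Q hQ hodd
      obtain ⟨v, hv, h0, h1⟩ := exists_partial_gadget hdeg hQ hodd
      have h := (sum_pairsAt_of_partial hm hdeg hQ hv h0 h1).1
      rw [← Finset.sum_product']
      exact le_trans (by omega)
        (h.trans (Finset.sum_le_sum_of_subset (Finset.filter_subset _ _))))
    (by
      intro Q hQ hodd h1 h2
      refine le_gadget_cut hm hdeg v₀ j₀ hcut hQ hodd (fun v u hvu => ?_)
        (fun h => h2 _ h (Or.inr rfl))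
      by_contra hu
      refine h1 _ hvu ⟨v, u, rfl, hu, ?_⟩
      rintro ⟨rfl, rfl⟩
      exact h2 _ hvu (Or.inl rfl))
  have hinl : ∀ v u, v ∈ X → G.Adj v u →
      (∃ j, f (.inl (v, u)) = .inr (v, j)) ∨ (u ∈ X ∧ f (.inl (v, u)) = .inl (u, v)) ∨
        (u ∉ X ∧ ¬ (v = v₀ ∧ u = w₀)) := by
    intro v u hv hvu
    obtain ⟨h1, h2, h3⟩ := hf (.inl (v, u)) (inl_mem_gadgetVerts.2 ⟨hv, hvu⟩)
    rcases hfu : f (.inl (v, u)) with ⟨a, b⟩ | ⟨a, j⟩ <;> rw [hfu] at h1 h2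
    · right
      have hab := inl_mem_gadgetVerts.1 h1
      simp only [gadgetGraph, SimpleGraph.fromRel_adj] at h2
      rcases h2.2 with (⟨h, h'⟩ | h) | (⟨h, h'⟩ | h)
      · left
        subst h h'
        exact ⟨hab.1, rfl⟩
      · exact Or.inr h.1
      · left
        subst h h'
        exact ⟨hab.1, rfl⟩
      · exact Or.inr h.2
    · left
      simp only [gadgetGraph, SimpleGraph.fromRel_adj] at h2
      rcases h2.2 with h | h
      · exact ⟨j, by rw [h]⟩
      · exact h.elim
  have hinr : ∀ v (j : Fin m), v ∈ X → ∃ u, G.Adj v u ∧ f (.inr (v, j)) = .inl (v, u) := by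
    intro v j hv
    obtain ⟨h1, h2, h3⟩ := hf (.inr (v, j)) (inr_mem_gadgetVerts.2 hv)
    rcases hfu : f (.inr (v, j)) with ⟨a, b⟩ | ⟨a, i⟩ <;> rw [hfu] at h1 h2 <;>
      simp only [gadgetGraph, SimpleGraph.fromRel_adj] at h2
    · have hab := inl_mem_gadgetVerts.1 h1
      rcases h2.2 with h | h
      · exact h.elim
      · subst h
        exact ⟨b, hab.2, rfl⟩
    · exact absurd h2.2 (by simp)
  let keep : V → V → Prop := fun v u => ∃ j, f (.inl (v, u)) = .inr (v, j)
  have hkeep : ∀ v u, v ∈ X → u ∈ X → G.Adj v u → keep v u → keep u v := by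
    intro v u hv hu hvu ⟨j, hj⟩
    rcases hinl u v hu hvu.symm with h | h | h
    · exact h
    · have := (hf (.inl (u, v)) (inl_mem_gadgetVerts.2 ⟨hu, hvu.symm⟩)).2.2
      rw [h.2, hj] at this
      simp at this
    · exact absurd hv h.1
  let F : SimpleGraph V :=
    { Adj := fun v u => G.Adj v u ∧ (v ∈ X → keep v u) ∧ (u ∈ X → keep u v)
      symm := ⟨fun v u h => ⟨h.1.symm, h.2.2, h.2.1⟩⟩
      loopless := ⟨fun v h => G.loopless.irrefl v h.1⟩ }
  refine ⟨F, fun v u h => h.1, fun v hv => ?_, fun hw hvw => ?_⟩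
  · choose g hg using fun j => hinr v j hv
    have hset : {u | F.Adj v u} = Set.range g := by
      ext u
      constructor
      · rintro ⟨hvu, h, -⟩
        obtain ⟨j, hj⟩ := h hv
        refine ⟨j, ?_⟩
        have := (hf (.inl (v, u)) (inl_mem_gadgetVerts.2 ⟨hv, hvu⟩)).2.2
        rw [hj, (hg j).2] at this
        simpa using this
      · rintro ⟨j, rfl⟩
        have hk : keep v (g j) := by
          refine ⟨j, ?_⟩
          rw [← (hg j).2]
          exact (hf (.inr (v, j)) (inr_mem_gadgetVerts.2 hv)).2.2
        exact ⟨(hg j).1, fun _ => hk, fun hu => hkeep v _ hv hu (hg j).1 hk⟩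
    have hinj : Function.Injective g := by
      intro i j hij
      have hi := (hf (.inr (v, i)) (inr_mem_gadgetVerts.2 hv)).2.2
      have hj := (hf (.inr (v, j)) (inr_mem_gadgetVerts.2 hv)).2.2
      rw [(hg i).2, hij, ← (hg j).2, hj] at hi
      simpa using hi.symm
    rw [hset, ← Set.image_univ, Set.ncard_image_of_injective _ hinj, Set.ncard_univ,
      Nat.card_eq_fintype_card, Fintype.card_fin]
  · refine ⟨hvw, fun _ => ?_, fun h => absurd h hw⟩
    rcases hinl v₀ w₀ hv₀ hvw with h | h | h
    · exact h
    · exact absurd h.1 hw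
    · exact absurd ⟨rfl, rfl⟩ h.2

end Gadget

theorem ne_bot_of_ncard_pos {V : Type*} {G : SimpleGraph V} {v : V} (h : 0 < {u | G.Adj v u}.ncard) :
    G ≠ ⊥ := by
  rintro rfl
  simp at h

section Reduction

variable {V : Type*} [Fintype V]

theorem exists_zero_or_eq_on (G : SimpleGraph V) {m : ℕ} (hm : 3 ≤ m) (X : Finset V)
    (hdeg : ∀ v ∈ X, {u | G.Adj v u}.ncard = m + 2) (v₀ : V) (hv₀ : v₀ ∈ X) (w₀ : V) :
    ∃ F ≤ G, (∀ v ∈ X, {u | F.Adj v u}.ncard = 0 ∨ {u | F.Adj v u}.ncard = m) ∧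
      {u | F.Adj v₀ u}.ncard = m ∧ (w₀ ∉ X → G.Adj v₀ w₀ → F.Adj v₀ w₀) := by
  classical
  induction X using Finset.strongInduction generalizing v₀ w₀ with
  | H X ih =>
  by_cases hcut : ∀ Y ⊆ X, Y.Nonempty → v₀ ∉ Y →
      2 ≤ ((Y ×ˢ (X \ Y)).filter fun d => G.Adj d.1 d.2).card
  · obtain ⟨F, hF, h1, h2⟩ := exists_regularOn_of_two_le_cut (G := G) (X := X) hm
      (fun v hv => by
        rw [← hdeg v hv, ← SimpleGraph.card_neighborFinset_eq_degree, ← Set.ncard_coe_finset]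
        congr 1
        ext u
        simp) v₀ hv₀ w₀ hcut
    exact ⟨F, hF, fun v hv => Or.inr (h1 v hv), h1 _ hv₀, h2⟩
  push Not at hcut
  obtain ⟨Y, hYX, hY, hv₀Y, hlt⟩ := hcut
  have huniq : ∀ y ∈ Y, ∀ b ∈ X \ Y, G.Adj y b → ∀ y' ∈ Y, ∀ b' ∈ X \ Y, G.Adj y' b' →
      y' = y ∧ b' = b := by
    intro y hy b hb h y' hy' b' hb' h'
    have := Finset.card_le_one.1 (Nat.le_of_lt_succ hlt) (y', b')
      (Finset.mem_filter.2 ⟨Finset.mem_product.2 ⟨hy', hb'⟩, h'⟩) (y, b)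
      (Finset.mem_filter.2 ⟨Finset.mem_product.2 ⟨hy, hb⟩, h⟩)
    simpa using this
  have hv₀' : v₀ ∈ X \ Y := Finset.mem_sdiff.2 ⟨hv₀, hv₀Y⟩
  obtain ⟨F₁, hF₁, h₁, h₁v, h₁w⟩ := ih (X \ Y) (Finset.sdiff_ssubset hYX hY)
    (fun v hv => hdeg v (Finset.mem_sdiff.1 hv).1) v₀ hv₀' w₀
  obtain ⟨F₂, hF₂, h₂, h₁₂⟩ : ∃ F₂ ≤ G,
      (∀ v ∈ Y, {u | F₂.Adj v u}.ncard = 0 ∨ {u | F₂.Adj v u}.ncard = m) ∧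
      ∀ y ∈ Y, ∀ b ∈ X \ Y, (F₁.Adj y b ↔ F₂.Adj y b) := by
    by_cases h : ∃ y ∈ Y, ∃ b ∈ X \ Y, F₁.Adj y b
    · obtain ⟨y, hy, b, hb, hyb⟩ := h
      obtain ⟨F₂, hF₂, h₂, -, h₂w⟩ := ih Y
        (Finset.ssubset_iff_subset_ne.2 ⟨hYX, fun h => hv₀Y (h ▸ hv₀)⟩)
        (fun v hv => hdeg v (hYX hv)) y hy b
      have hyb₂ := h₂w (Finset.mem_sdiff.1 hb).2 (hF₁ hyb)
      refine ⟨F₂, hF₂, h₂, fun y' hy' b' hb' => ⟨fun h => ?_, fun h => ?_⟩⟩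
      · obtain ⟨rfl, rfl⟩ := huniq y hy b hb (hF₁ hyb) y' hy' b' hb' (hF₁ h)
        exact hyb₂
      · obtain ⟨rfl, rfl⟩ := huniq y hy b hb (hF₁ hyb) y' hy' b' hb' (hF₂ h)
        exact hyb
    · push Not at h
      exact ⟨⊥, bot_le, fun v _ => Or.inl (by simp), fun y hy b hb => by simp [h y hy b hb]⟩
  let F : SimpleGraph V :=
    { Adj := fun v u => (F₁.Adj v u ∧ (v ∈ X \ Y ∨ u ∈ X \ Y)) ∨ (F₂.Adj v u ∧ (v ∈ Y ∨ u ∈ Y))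
      symm := ⟨fun v u h => by simpa only [F₁.adj_comm, F₂.adj_comm, or_comm] using h⟩
      loopless := ⟨fun v h => h.elim (fun h => F₁.irrefl h.1) fun h => F₂.irrefl h.1⟩ }
  have hF1 : ∀ v ∈ X \ Y, ∀ u, F.Adj v u ↔ F₁.Adj v u := by
    intro v hv u
    refine ⟨?_, fun h => Or.inl ⟨h, Or.inl hv⟩⟩
    rintro (h | ⟨h, h' | h'⟩)
    · exact h.1
    · exact absurd h' (Finset.mem_sdiff.1 hv).2
    · exact ((h₁₂ u h' v hv).2 h.symm).symm
  have hF2 : ∀ v ∈ Y, ∀ u, F.Adj v u ↔ F₂.Adj v u := by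
    intro v hv u
    refine ⟨?_, fun h => Or.inr ⟨h, Or.inl hv⟩⟩
    rintro (⟨h, h' | h'⟩ | h)
    · exact absurd hv (Finset.mem_sdiff.1 h').2
    · exact (h₁₂ v hv u h').1 h
    · exact h.1
  refine ⟨F, ?_, fun v hv => ?_, ?_, fun hw hvw => ?_⟩
  · rintro v u (h | h)
    · exact hF₁ h.1
    · exact hF₂ h.1
  · by_cases hvY : v ∈ Y
    · simpa only [hF2 v hvY] using h₂ v hvY
    · have hv' := Finset.mem_sdiff.2 ⟨hv, hvY⟩
      simpa only [hF1 v hv'] using h₁ v hv'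
  · simpa only [hF1 v₀ hv₀'] using h₁v
  · exact (hF1 v₀ hv₀' w₀).2 (h₁w (fun h => hw (Finset.mem_sdiff.1 h).1) hvw)

theorem exists_zero_or_eq_of_zero_or_add_two (G : SimpleGraph V) {m : ℕ} (hm : 3 ≤ m)
    (hG : G ≠ ⊥) (hdeg : ∀ v, {u | G.Adj v u}.ncard = 0 ∨ {u | G.Adj v u}.ncard = m + 2) :
    ∃ F ≤ G, F ≠ ⊥ ∧ ∀ v, {u | F.Adj v u}.ncard = 0 ∨ {u | F.Adj v u}.ncard = m := by
  classical
  obtain ⟨v₀, w, hvw⟩ := SimpleGraph.ne_bot_iff_exists_adj.1 hG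
  have hne : {u | G.Adj v₀ u}.ncard ≠ 0 :=
    ((Set.ncard_pos (Set.toFinite _)).2 ⟨w, hvw⟩).ne'
  obtain ⟨F, hF, h1, h2, -⟩ := exists_zero_or_eq_on G hm
    (Finset.univ.filter fun v => {u | G.Adj v u}.ncard = m + 2) (fun v hv => by simpa using hv)
    v₀ (by simpa using (hdeg v₀).resolve_left hne) v₀
  refine ⟨F, hF, ne_bot_of_ncard_pos (v := v₀) (by omega), fun v => ?_⟩
  rcases hdeg v with h | h
  · left
    have := Set.ncard_le_ncard (fun u (hu : F.Adj v u) => hF hu) (Set.toFinite {u | G.Adj v u})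
    exact Nat.le_zero.1 (h ▸ this)
  · exact h1 v (by simpa using h)

theorem exists_zero_or_eq_of_zero_or_add_two_mul {k : ℕ} (hk : 3 ≤ k) (t : ℕ) (G : SimpleGraph V)
    (hG : G ≠ ⊥) (hdeg : ∀ v, {u | G.Adj v u}.ncard = 0 ∨ {u | G.Adj v u}.ncard = k + 2 * t) :
    ∃ F ≤ G, F ≠ ⊥ ∧ ∀ v, {u | F.Adj v u}.ncard = 0 ∨ {u | F.Adj v u}.ncard = k := by
  induction t generalizing G with
  | zero => exact ⟨G, le_rfl, hG, hdeg⟩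
  | succ t ih =>
    obtain ⟨F, hF, hF0, hFd⟩ := exists_zero_or_eq_of_zero_or_add_two G (m := k + 2 * t)
      (by omega) hG (by simpa only [mul_add, mul_one, add_assoc] using hdeg)
    obtain ⟨F', hF', h⟩ := ih F hF0 hFd
    exact ⟨F', hF'.trans hF, h⟩

theorem exists_fibers_card_eq {α : Type*} [DecidableEq α] {p : ℕ} (hp : 0 < p) (S : Finset α)
    (hS : p ∣ S.card) :
    ∃ g : α → α, (∀ u ∈ S, g u ∈ S) ∧
      ∀ i, (S.filter fun u => g u = i).card = 0 ∨ (S.filter fun u => g u = i).card = p := by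
  induction S using Finset.strongInduction with
  | H S ih =>
  rcases S.eq_empty_or_nonempty with rfl | hne
  · exact ⟨id, by simp⟩
  obtain ⟨T, hTS, hT⟩ := Finset.exists_subset_card_eq (Nat.le_of_dvd hne.card_pos hS)
  obtain ⟨t, ht⟩ : T.Nonempty := Finset.card_pos.1 (hT ▸ hp)
  obtain ⟨g, hg, hgc⟩ := ih (S \ T) (Finset.sdiff_ssubset hTS ⟨t, ht⟩)
    (by rw [Finset.card_sdiff_of_subset hTS, hT]; exact Nat.dvd_sub hS dvd_rfl)
  refine ⟨fun u => if u ∈ T then t else g u, fun u hu => ?_, fun i => ?_⟩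
  · by_cases h : u ∈ T
    · simpa [h] using hTS ht
    · simpa [h] using (Finset.mem_sdiff.1 (hg u (Finset.mem_sdiff.2 ⟨hu, h⟩))).1
  · by_cases hi : i = t
    · right
      rw [← hT]
      congr 1
      ext u
      subst hi
      by_cases h : u ∈ T
      · simp [h, hTS h]
      · simp only [Finset.mem_filter, h, if_false, iff_false, not_and]
        rintro hu rfl
        exact (Finset.mem_sdiff.1 (hg u (Finset.mem_sdiff.2 ⟨hu, h⟩))).2 ht
    · convert hgc i using 3 <;>
      · ext u
        by_cases h : u ∈ T
        · simp [h, Ne.symm hi]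
        · simp [h]

/-- Splitting every vertex into vertices of degree `p` turns subgraphs with degrees in `{0, k}`
of the split graph into `k`-divisible subgraphs of the original graph. -/
theorem exists_kDivisible_of_kDivisible {p k : ℕ} (hk : 3 ≤ k) (t : ℕ) (hp : p = k + 2 * t)
    (H : SimpleGraph V) (hH : H ≠ ⊥) (hdiv : KDivisible p H) :
    ∃ F ≤ H, F ≠ ⊥ ∧ KDivisible k F := by
  classical
  have hcard : ∀ v, p ∣ (Finset.univ.filter fun u => H.Adj v u).card := fun v => by
    rw [← Set.ncard_coe_finset]
    simpa using hdiv v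
  choose g _ hg using fun v => exists_fibers_card_eq (p := p) (by omega) _ (hcard v)
  let H' : SimpleGraph (V × V) :=
    { Adj := fun x y => H.Adj x.1 y.1 ∧ g x.1 y.1 = x.2 ∧ g y.1 x.1 = y.2
      symm := ⟨fun x y h => ⟨h.1.symm, h.2.2, h.2.1⟩⟩
      loopless := ⟨fun x h => H.irrefl h.1⟩ }
  have hdeg : ∀ (F' : SimpleGraph (V × V)), F' ≤ H' → ∀ v i, {y | F'.Adj (v, i) y}.ncard =
      (Finset.univ.filter fun u => F'.Adj (v, i) (u, g u v)).card := by
    intro F' hF' v i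
    rw [← Set.ncard_coe_finset]
    have hinj : Function.Injective fun u => (u, g u v) := fun a b h => (Prod.ext_iff.1 h).1
    rw [← Set.ncard_image_of_injective _ hinj]
    congr 1
    ext ⟨u, j⟩
    simp only [Set.mem_ofPred_eq, Finset.coe_filter, Finset.mem_univ, true_and, Set.mem_image,
      Prod.mk.injEq]
    constructor
    · intro h
      obtain rfl : g u v = j := (hF' h).2.2
      exact ⟨u, h, rfl, rfl⟩
    · rintro ⟨u, h, rfl, rfl⟩
      exact h
  obtain ⟨F', hF', hF'0, hF'd⟩ := exists_zero_or_eq_of_zero_or_add_two_mul hk t H'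
    (by
      obtain ⟨v, u, h⟩ := SimpleGraph.ne_bot_iff_exists_adj.1 hH
      exact SimpleGraph.ne_bot_iff_exists_adj.2 ⟨(v, g v u), (u, g u v), h, rfl, rfl⟩)
    (by
      rintro ⟨v, i⟩
      rw [hdeg H' le_rfl, ← hp]
      convert hg v i using 3 <;>
      · ext u
        simp [H'])
  let F : SimpleGraph V :=
    { Adj := fun v u => F'.Adj (v, g v u) (u, g u v)
      symm := ⟨fun v u h => h.symm⟩
      loopless := ⟨fun v h => F'.irrefl h⟩ }
  refine ⟨F, fun v u h => (hF' h).1, ?_, fun v => ?_⟩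
  · obtain ⟨⟨v, i⟩, ⟨u, j⟩, h⟩ := SimpleGraph.ne_bot_iff_exists_adj.1 hF'0
    obtain ⟨-, hi, hj⟩ := hF' h
    dsimp only at hi hj
    subst hi hj
    exact SimpleGraph.ne_bot_iff_exists_adj.2 ⟨v, u, h⟩
  · have : {u | F.Adj v u} = ((Finset.univ.filter fun u => F.Adj v u : Finset V) : Set V) := by
      simp
    rw [this, Set.ncard_coe_finset,
      Finset.card_eq_sum_card_fiberwise (f := g v) (t := Finset.univ) (fun _ _ => by simp)]
    refine Finset.dvd_sum fun i _ => ?_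
    have heq : ((Finset.univ.filter fun u => F.Adj v u).filter fun u => g v u = i) =
        Finset.univ.filter fun u => F'.Adj (v, i) (u, g u v) := by
      ext u
      simp only [Finset.mem_filter, Finset.mem_univ, true_and]
      constructor
      · rintro ⟨h, rfl⟩
        exact h
      · intro h
        obtain rfl : g v u = i := (hF' h).2.1
        exact ⟨h, rfl⟩
    rw [heq, ← hdeg F' hF']
    rcases hF'd (v, i) with h | h <;> rw [h]
    exact dvd_zero k

end Reduction

section Main

variable {V : Type*} [Fintype V]

theorem exists_kDivisible_of_card_lt (G : SimpleGraph V) {p : ℕ} (hp : p.Prime) (W : Finset V)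
    (hW : ∀ v u, G.Adj v u → v ∈ W) (hcard : W.card * (p - 1) < G.edgeSet.ncard) :
    ∃ H ≤ G, H ≠ ⊥ ∧ KDivisible p H := by
  classical
  have : Fact p.Prime := ⟨hp⟩
  let f : V → MvPolynomial G.edgeSet (ZMod p) := fun v =>
    ∑ e ∈ Finset.univ.filter fun e : G.edgeSet => v ∈ e.1, MvPolynomial.X e ^ (p - 1)
  have hdeg : ∀ v, (f v).totalDegree ≤ p - 1 := fun v =>
    MvPolynomial.totalDegree_finsetSum_le fun e _ => (MvPolynomial.totalDegree_X_pow e _).le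
  have heval : ∀ v (x : G.edgeSet → ZMod p), MvPolynomial.eval x (f v) =
      (Finset.univ.filter fun e : G.edgeSet => v ∈ e.1 ∧ x e ≠ 0).card := by
    intro v x
    simp only [f, map_sum, map_pow, MvPolynomial.eval_X]
    rw [← Finset.filter_filter, Finset.card_filter, Nat.cast_sum]
    refine Finset.sum_congr rfl fun e _ => ?_
    by_cases h : x e = 0
    · simp [h, Nat.sub_ne_zero_of_lt hp.one_lt]
    · simp [h, ZMod.pow_card_sub_one_eq_one h]
  have hdvd := char_dvd_card_solutions_of_sum_lt p (s := W) (f := f) (by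
    rw [← Nat.card_eq_fintype_card, Nat.card_coe_set_eq]
    exact (Finset.sum_le_card_nsmul _ _ _ fun v _ => hdeg v).trans_lt hcard)
  let z : { x : G.edgeSet → ZMod p // ∀ v ∈ W, MvPolynomial.eval x (f v) = 0 } :=
    ⟨0, fun v _ => by rw [heval]; simp⟩
  rw [Fintype.card_eq_nat_card] at hdvd
  have hone := hp.one_lt.trans_le (Nat.le_of_dvd (Finite.card_pos_iff.2 ⟨z⟩) hdvd)
  have := Finite.one_lt_card_iff_nontrivial.1 hone
  obtain ⟨⟨x, hx⟩, hne⟩ := exists_ne z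
  obtain ⟨e₀, he₀⟩ : ∃ e, x e ≠ 0 := by
    by_contra! h
    exact hne (Subtype.ext (funext h))
  let H : SimpleGraph V :=
    { Adj := fun v u => ∃ h : s(v, u) ∈ G.edgeSet, x ⟨_, h⟩ ≠ 0
      symm := ⟨fun v u => by rw [Sym2.eq_swap]; exact id⟩
      loopless := ⟨fun v h => G.irrefl h.1⟩ }
  refine ⟨H, fun v u h => h.1, ?_, fun v => ?_⟩
  · obtain ⟨e, he⟩ := e₀
    induction e using Sym2.ind with
    | _ v u => exact SimpleGraph.ne_bot_iff_exists_adj.2 ⟨v, u, he, he₀⟩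
  · by_cases hv : v ∈ W
    · have h := hx v hv
      rw [heval, ZMod.natCast_eq_zero_iff] at h
      convert h
      rw [← Set.ncard_coe_finset]
      refine Set.ncard_congr (fun u (hu : H.Adj v u) => ⟨s(v, u), hu.1⟩) (fun u hu => ?_)
        (fun u w hu hw h => ?_) fun e he => ?_
      · simpa using hu.2
      · exact Sym2.congr_right.1 (Subtype.ext_iff.1 h)
      · obtain ⟨e, heG⟩ := e
        simp only [Finset.coe_filter, Finset.mem_univ, true_and, Set.mem_ofPred_eq] at he
        obtain ⟨⟨u, rfl⟩, hxe⟩ := he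
        exact ⟨u, ⟨heG, hxe⟩, rfl⟩
    · have : {u | H.Adj v u} = ∅ := Set.eq_empty_of_forall_notMem fun u h => hv (hW v u h.1)
      rw [this, Set.ncard_empty]
      exact dvd_zero p

theorem exists_kDivisible_of_two_mul_le_degree (G : SimpleGraph V) {p : ℕ} (hp : p.Prime)
    (W : Finset V) (hne : W.Nonempty)
    (hW : ∀ v ∈ W, 2 * p - 1 ≤ {u | G.Adj v u ∧ u ∈ W}.ncard) :
    ∃ H ≤ G, H ≠ ⊥ ∧ KDivisible p H := by
  classical
  let G' : SimpleGraph V :=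
    { Adj := fun v u => G.Adj v u ∧ v ∈ W ∧ u ∈ W
      symm := ⟨fun v u h => ⟨h.1.symm, h.2.2, h.2.1⟩⟩
      loopless := ⟨fun v h => G.irrefl h.1⟩ }
  have hdeg : ∀ v ∈ W, 2 * p - 1 ≤ G'.degree v := by
    intro v hv
    rw [← SimpleGraph.card_neighborFinset_eq_degree, ← Set.ncard_coe_finset]
    convert hW v hv
    ext u
    simp [G', hv]
  have hsum : W.card * (2 * p - 1) ≤ 2 * G'.edgeFinset.card := by
    rw [← G'.sum_degrees_eq_twice_card_edges, ← smul_eq_mul]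
    exact (Finset.card_nsmul_le_sum _ _ _ hdeg).trans
      (Finset.sum_le_sum_of_subset (Finset.subset_univ _))
  obtain ⟨H, hH, h⟩ := exists_kDivisible_of_card_lt G' hp W (fun v u h => h.2.1) (by
    rw [← SimpleGraph.coe_edgeFinset, Set.ncard_coe_finset]
    obtain ⟨a, rfl⟩ : ∃ a, p = a + 1 := ⟨p - 1, by have := hp.pos; omega⟩
    have h1 : 2 * (a + 1) - 1 = 2 * a + 1 := by omega
    rw [h1] at hsum
    have := hne.card_pos
    simp only [Nat.add_sub_cancel]
    nlinarith)
  exact ⟨H, hH.trans fun v u h => h.1, h⟩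

theorem degenerate_of_exists_ncard_le (G : SimpleGraph V) {d : ℕ}
    (h : ∀ W : Finset V, W.Nonempty → ∃ v ∈ W, {u | G.Adj v u ∧ u ∈ W}.ncard ≤ d) :
    Degenerate G d := by
  classical
  have key : ∀ W : Finset V, ∃ o : V → ℕ, Set.InjOn o W ∧ (∀ v ∈ W, o v < W.card) ∧
      ∀ v ∈ W, {u | G.Adj v u ∧ u ∈ W ∧ o u < o v}.ncard ≤ d := by
    intro W
    induction W using Finset.strongInduction with
    | H W ih =>
    rcases W.eq_empty_or_nonempty with rfl | hW
    · exact ⟨fun _ => 0, by simp⟩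
    obtain ⟨w, hw, hwd⟩ := h W hW
    obtain ⟨o, hinj, hlt, hd⟩ := ih (W.erase w) (Finset.erase_ssubset hw)
    have hc := Finset.card_erase_add_one hw
    have ho : ∀ v ∈ W, v ≠ w → o v < (W.erase w).card := fun v hv hvw =>
      hlt v (Finset.mem_erase.2 ⟨hvw, hv⟩)
    refine ⟨Function.update o w (W.erase w).card, fun a ha b hb hab => ?_, fun v hv => ?_,
      fun v hv => ?_⟩
    · rw [Finset.mem_coe] at ha hb
      by_cases h1 : a = w <;> by_cases h2 : b = w
      · rw [h1, h2]
      · subst h1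
        have := ho b hb h2
        simp [h2] at hab
        omega
      · subst h2
        have := ho a ha h1
        simp [h1] at hab
        omega
      · simp only [Function.update_of_ne h1, Function.update_of_ne h2] at hab
        exact hinj (by simp [h1, ha]) (by simp [h2, hb]) hab
    · by_cases h1 : v = w
      · subst h1
        simp only [Function.update_self]
        omega
      · have := ho v hv h1
        simp only [Function.update_of_ne h1]
        omega
    · by_cases h1 : v = w
      · subst h1
        exact (Set.ncard_le_ncard (t := {u | G.Adj v u ∧ u ∈ W}) (fun u hu => ⟨hu.1, hu.2.1⟩)
          (Set.toFinite _)).trans hwd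
      · refine (Set.ncard_le_ncard (fun u hu => ?_) (Set.toFinite _)).trans
          (hd v (Finset.mem_erase.2 ⟨h1, hv⟩))
        obtain ⟨hvu, hu, hlt'⟩ := hu
        have := ho v hv h1
        by_cases h2 : u = w
        · subst h2
          simp only [Function.update_of_ne h1, Function.update_self] at hlt'
          omega
        · simp only [Function.update_of_ne h1, Function.update_of_ne h2] at hlt'
          exact ⟨hvu, Finset.mem_erase.2 ⟨h2, hu⟩, hlt'⟩
  obtain ⟨o, hinj, -, hd⟩ := key Finset.univ
  refine ⟨o, by simpa using hinj, fun v => by simpa using hd v (Finset.mem_univ v)⟩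

end Main

theorem q_spec (m : ℕ) : (q m).Prime ∧ m ≤ q m :=
  Nat.sInf_mem (s := {p : ℕ | p.Prime ∧ m ≤ p})
    ((Nat.exists_infinite_primes m).imp fun _ h => ⟨h.2, h.1⟩)

theorem statement13 (k : ℕ) (hk : 3 ≤ k) (hkodd : Odd k)
    (V : Type) [Fintype V] (G : SimpleGraph V) (hG : NoKDivisibleSubgraph k G) :
    Degenerate G (2 * q k - 2) := by
  obtain ⟨hp, hkp⟩ := q_spec k
  refine degenerate_of_exists_ncard_le G fun W hW => ?_
  by_contra! hdeg
  obtain ⟨H, hHG, hH, hdiv⟩ := exists_kDivisible_of_two_mul_le_degree G hp W hW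
    fun v hv => by have := hdeg v hv; omega
  obtain ⟨t, ht⟩ : ∃ t, q k = k + 2 * t := by
    obtain ⟨a, ha⟩ := hkodd
    obtain ⟨b, hb⟩ := hp.odd_of_ne_two (by omega)
    exact ⟨b - a, by omega⟩
  obtain ⟨F, hF, hF0, hFd⟩ := exists_kDivisible_of_kDivisible hk t ht H hH hdiv
  exact hF0 (hG F (hF.trans hHG) hFd)
end

section
/- Let k ≥ 3 be an odd integer, let G be a finite simple graph, and let H be a subgraph of G in which every vertex incident to an edge of H has degree in H congruent to 1 modulo k, chosen with the maximum number of edges among all such subgraphs of G. Then the graph G' obtained from G by deleting the edges of H is (2q(k) + k − 3)-degenerate. -/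
/-- `H` is a subgraph of `G` in which every vertex incident to an edge of `H` has degree
in `H` congruent to `1` modulo `k`. -/
def IsMod1Subgraph {V : Type*} (k : ℕ) (G H : SimpleGraph V) : Prop :=
  H ≤ G ∧ ∀ v ∈ H.support, {u : V | H.Adj v u}.ncard % k = 1

/-- `H` is such a subgraph of `G`, with the maximum number of edges among all of them. -/
def IsMaxMod1Subgraph {V : Type*} (k : ℕ) (G H : SimpleGraph V) : Prop :=
  IsMod1Subgraph k G H ∧
    ∀ H' : SimpleGraph V, IsMod1Subgraph k G H' → H'.edgeSet.ncard ≤ H.edgeSet.ncard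

open Finset in
/-- A sufficient condition for a perfect matching: every vertex distributes charge at most one to
its neighbours, and every odd set avoiding the clique `L` receives charge at least one from
outside. -/
theorem SimpleGraph.exists_isPerfectMatching_of_charge {X : Type*} [Fintype X]
    (Γ : SimpleGraph X) (heven : Even (Fintype.card X)) (L : Set X) (hL : Γ.IsClique L)
    (c : X → X → ℚ) (hc0 : ∀ s x, 0 ≤ c s x) (hadj : ∀ s x, c s x ≠ 0 → Γ.Adj s x)
    (hc1 : ∀ s, ∑ x, c s x ≤ 1)
    (hcut : ∀ C : Set X, Odd C.ncard → Disjoint C L →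
      1 ≤ ∑ s, ∑ x, C.indicator 1 x * Cᶜ.indicator 1 s * c s x) :
    ∃ M : Γ.Subgraph, M.IsPerfectMatching := by
  classical
  rw [SimpleGraph.tutte]
  intro u hu
  unfold IsTutteViolator at hu
  set Δ := ((⊤ : Γ.Subgraph).deleteVerts u).coe with hΔ
  have hmem (x : ((⊤ : Γ.Subgraph).deleteVerts u).verts) : (x : X) ∉ u := by
    have := x.2
    simpa using this
  have hodd := Δ.odd_ncard_oddComponents
  have hcard : Nat.card ((⊤ : Γ.Subgraph).deleteVerts u).verts + u.ncard = Fintype.card X := by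
    rw [Nat.card_coe_set_eq]
    have : ((⊤ : Γ.Subgraph).deleteVerts u).verts = uᶜ := by ext; simp
    rw [this, add_comm, Set.ncard_add_ncard_compl, Nat.card_eq_fintype_card]
  have hgap : u.ncard + 2 ≤ Δ.oddComponents.ncard := by
    have h1 : Δ.oddComponents.ncard ≠ u.ncard + 1 := by
      intro h
      rw [h] at hodd
      grind
    omega
  let im : Δ.ConnectedComponent → Set X := fun C => (↑) '' C.supp
  have him (C) (x) : x ∈ im C → x ∉ u := by
    rintro ⟨y, -, rfl⟩; exact hmem y
  have himadj (C) (s x) (hx : x ∈ im C) (hs : s ∉ u) (h : Γ.Adj s x) : s ∈ im C := by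
    obtain ⟨y, hy, rfl⟩ := hx
    refine ⟨⟨s, by simpa using hs⟩, ?_, rfl⟩
    rw [ConnectedComponent.mem_supp_iff] at hy ⊢
    rw [← hy]
    apply ConnectedComponent.sound
    apply Adj.reachable
    have := hmem y
    simp [Δ, hs, h, this]
  have himeq (C D) (x) (hC : x ∈ im C) (hD : x ∈ im D) : C = D := by
    obtain ⟨y, hy, rfl⟩ := hC
    obtain ⟨z, hz, hzy⟩ := hD
    obtain rfl : z = y := Subtype.ext hzy
    rw [ConnectedComponent.mem_supp_iff] at hy hz
    rw [← hy, ← hz]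
  -- all but at most one odd component avoid `L`
  let T : Finset Δ.ConnectedComponent := {C | Odd C.supp.ncard ∧ Disjoint (im C) L}
  have hT : Δ.oddComponents.ncard ≤ #T + 1 := by
    have hsub : Δ.oddComponents ⊆ (T : Set _) ∪ {C | ¬ Disjoint (im C) L} := by
      intro C hC
      by_cases h : Disjoint (im C) L
      · left; simpa [T, h] using hC
      · right; exact h
    have h1 : ({C | ¬ Disjoint (im C) L} : Set Δ.ConnectedComponent).ncard ≤ 1 := by
      rw [Set.ncard_le_one]
      intro C hC D hD
      simp only [Set.mem_ofPred_eq, Set.not_disjoint_iff] at hC hD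
      obtain ⟨x, hxC, hxL⟩ := hC
      obtain ⟨y, hyD, hyL⟩ := hD
      by_cases hxy : x = y
      · subst hxy; exact himeq _ _ _ hxC hyD
      · exact himeq _ _ _ hxC (himadj D x y hyD (him C x hxC) (hL hxL hyL hxy))
    calc _ ≤ _ := Set.ncard_le_ncard hsub
      _ ≤ _ := Set.ncard_union_le _ _
      _ ≤ _ := by rw [Set.ncard_coe_finset]; omega
  have hsum : (#T : ℚ) ≤ u.ncard := by
    calc (#T : ℚ) = ∑ C ∈ T, 1 := by simp
      _ ≤ ∑ C ∈ T, ∑ s, ∑ x, (im C).indicator 1 x * (im C)ᶜ.indicator 1 s * c s x := by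
        apply sum_le_sum
        intro C hC
        simp only [T, mem_filter, mem_univ, true_and] at hC
        apply hcut _ _ hC.2
        rw [Set.ncard_image_of_injective _ Subtype.val_injective]
        exact hC.1
      _ ≤ ∑ C ∈ T, ∑ s, ∑ x, (im C).indicator 1 x * (u.indicator 1 s * c s x) := by
        apply sum_le_sum; intro C hC
        apply sum_le_sum; intro s hs
        apply sum_le_sum; intro x hx
        by_cases hxC : x ∈ im C <;> by_cases hsC : s ∈ im C <;> by_cases hsu : s ∈ u <;>
          simp [hxC, hsC, hsu, hc0]
        by_contra! h
        exact hsC (himadj C s x hxC hsu (hadj _ _ h.ne'))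
      _ = ∑ s, ∑ x, (∑ C ∈ T, (im C).indicator 1 x) * (u.indicator 1 s * c s x) := by
        rw [sum_comm]
        refine sum_congr rfl fun s _ => ?_
        rw [sum_comm]
        simp_rw [sum_mul]
      _ ≤ ∑ s, ∑ x, 1 * (u.indicator 1 s * c s x) := by
        apply sum_le_sum; intro s hs
        apply sum_le_sum; intro x hx
        have h0 : 0 ≤ u.indicator 1 s * c s x :=
          mul_nonneg (Set.indicator_nonneg (by simp) _) (hc0 _ _)
        refine mul_le_mul_of_nonneg_right ?_ h0
        by_cases hx : ∃ C ∈ T, x ∈ im C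
        · obtain ⟨C, hC, hxC⟩ := hx
          rw [sum_eq_single_of_mem C hC]
          · simp [hxC]
          · intro D _ hD
            rw [Set.indicator_of_notMem]
            intro hxD
            exact hD (himeq _ _ _ hxD hxC)
        · push Not at hx
          rw [sum_eq_zero]
          · simp
          · intro C hC
            rw [Set.indicator_of_notMem (hx C hC)]
      _ = ∑ s, u.indicator 1 s * ∑ x, c s x := by simp [mul_sum]
      _ ≤ ∑ s, u.indicator 1 s * 1 := by
        apply sum_le_sum; intro s hs
        exact mul_le_mul_of_nonneg_left (hc1 s) (Set.indicator_nonneg (by simp) _)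
      _ = u.ncard := by
        simp [Set.indicator_apply, Set.ncard_eq_toFinset_card']
  have : #T ≤ u.ncard := by exact_mod_cast hsum
  omega

/-- A lower bound for the charge crossing a cut near one vertex of degree `d`, when `a` of its darts
and `b` of its `c` core vertices lie inside the cut. -/
theorem charge_local {k q a b c d : ℕ} (hk : 0 < k) (hkq : k < q) (ha : a ≤ d) (hb : b ≤ c)
    (hcd : q * c = (q - k) * d) :
    (0 : ℚ) ≤ ((a : ℚ) * (c - b) + b * (d - a)) / d ∧
    ((1 : ℚ) ≤ ((a : ℚ) * (c - b) + b * (d - a)) / d ∨ (b = 0 ∨ b = c) ∧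
      (((q : ℚ) - k) / q ≤ ((a : ℚ) * (c - b) + b * (d - a)) / d ∨ (b = 0 ∧ a = 0) ∨
        (b = c ∧ a = d))) := by
  have hq : (0 : ℚ) < q := by exact_mod_cast hk.trans hkq
  have hcd' : (q : ℚ) * c = (q - k) * d := by
    have := congrArg (Nat.cast (R := ℚ)) hcd
    push_cast [Nat.cast_sub hkq.le] at this
    exact this
  have ha' : (a : ℚ) ≤ d := by exact_mod_cast ha
  have hb' : (b : ℚ) ≤ c := by exact_mod_cast hb
  have ha0 : (0 : ℚ) ≤ a := by positivity
  have hb0 : (0 : ℚ) ≤ b := by positivity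
  have hqk : (0 : ℚ) < q - k := by
    have : (k : ℚ) < q := by exact_mod_cast hkq
    linarith
  refine ⟨div_nonneg (add_nonneg (mul_nonneg ha0 (by linarith)) (mul_nonneg hb0 (by linarith)))
    (by positivity), ?_⟩
  rcases Nat.eq_zero_or_pos d with rfl | hd
  · have hc : c = 0 := by
      rcases Nat.mul_eq_zero.mp hcd with h | h <;> omega
    right
    exact ⟨by omega, by omega⟩
  have hd' : (0 : ℚ) < d := by exact_mod_cast hd
  rcases Nat.eq_zero_or_pos b with rfl | hb1
  · right
    refine ⟨Or.inl rfl, ?_⟩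
    rcases Nat.eq_zero_or_pos a with rfl | ha1
    · exact Or.inr (Or.inl ⟨rfl, rfl⟩)
    · left
      have ha1' : (1 : ℚ) ≤ a := by exact_mod_cast ha1
      rw [div_le_div_iff₀ hq hd', ← hcd']
      have : 0 ≤ (a - 1) * ((q : ℚ) * c) := mul_nonneg (by linarith) (by positivity)
      push_cast
      linarith
  rcases hb.eq_or_lt with rfl | hbc
  · right
    refine ⟨Or.inr rfl, ?_⟩
    rcases ha.eq_or_lt with rfl | had
    · exact Or.inr (Or.inr ⟨rfl, rfl⟩)
    · left
      have ha1' : (a : ℚ) + 1 ≤ d := by exact_mod_cast had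
      rw [div_le_div_iff₀ hq hd', ← hcd']
      have : 0 ≤ (d - a - 1) * ((q : ℚ) * b) := mul_nonneg (by linarith) (by positivity)
      linarith
  · left
    rw [le_div_iff₀ hd']
    have h1 : (1 : ℚ) ≤ b := by exact_mod_cast hb1
    have h2 : (b : ℚ) + 1 ≤ c := by exact_mod_cast hbc
    have h3 : 0 ≤ (a : ℚ) * (c - b - 1) := mul_nonneg ha0 (by linarith)
    have h4 : 0 ≤ (b - 1 : ℚ) * (d - a) := mul_nonneg (by linarith) (by linarith)
    linarith

namespace SimpleGraph

open Finset

/-- Tutte's gadget graph: darts, plus `c v` core vertices for each `v`; darts leaving a free vertex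
form a clique. -/
def degreeGadget {V : Type*} (F : SimpleGraph V) (L : Set V) (c : V → ℕ) :
    SimpleGraph (F.Dart ⊕ (Σ v, Fin (c v))) where
  Adj
    | .inl a, .inl b => a = b.symm ∨ (a ≠ b ∧ a.fst ∈ L ∧ b.fst ∈ L)
    | .inl a, .inr i => a.fst = i.1
    | .inr i, .inl a => a.fst = i.1
    | .inr _, .inr _ => False
  symm := ⟨by
    rintro (a | i) (b | j) h
    · rcases h with h | h
      · left; rw [h, Dart.symm_symm]
      · right; exact ⟨h.1.symm, h.2.2, h.2.1⟩
    · exact h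
    · exact h
    · exact h⟩
  loopless := ⟨by
    rintro (a | i) h
    · rcases h with h | h
      · exact a.symm_ne h.symm
      · exact h.1 rfl
    · exact h⟩

open Classical in
/-- A distribution of charge along the edges of the gadget graph, of total at most one at each
vertex. -/
noncomputable def gadgetCharge {V : Type*} [Fintype V] (F : SimpleGraph V) (L : Set V) (c : V → ℕ)
    (r : ℚ) : F.Dart ⊕ (Σ v, Fin (c v)) → F.Dart ⊕ (Σ v, Fin (c v)) → ℚ
  | .inl a, .inl b => if a = b.symm then (if a.fst ∈ L then 1 else r) else 0
  | .inl a, .inr i => if a.fst = i.1 then 1 / (F.degree i.1 : ℚ) else 0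
  | .inr i, .inl a => if a.fst = i.1 then 1 / (F.degree i.1 : ℚ) else 0
  | .inr _, .inr _ => 0

open Classical in
/-- The total charge crossing a cut of the gadget graph. -/
theorem sum_indicator_gadgetCharge {V : Type*} [Fintype V] (F : SimpleGraph V) (L : Set V)
    (c : V → ℕ) (r : ℚ) (C : Set (F.Dart ⊕ (Σ v, Fin (c v)))) (a b : V → ℕ)
    (ha : ∀ v, a v = #{d : F.Dart | d.fst = v ∧ .inl d ∈ C})
    (hb : ∀ v, b v = #{i : Fin (c v) | .inr ⟨v, i⟩ ∈ C}) :
    ∑ s, ∑ x, C.indicator 1 x * Cᶜ.indicator 1 s * gadgetCharge F L c r s x =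
      (∑ d : F.Dart with .inl d ∈ C ∧ .inl d.symm ∉ C, if d.snd ∈ L then 1 else r) +
      ∑ v, ((a v : ℚ) * (c v - b v) + b v * (F.degree v - a v)) / F.degree v := by
  have ha1 (v) : (a v : ℚ) = ∑ d : F.Dart, if d.fst = v then C.indicator 1 (.inl d) else 0 := by
    rw [ha, card_filter, Nat.cast_sum]
    refine sum_congr rfl fun d _ => ?_
    by_cases h1 : d.fst = v <;> by_cases h2 : Sum.inl d ∈ C <;> simp [h1, h2]
  have hdeg (v) : (F.degree v : ℚ) = ∑ d : F.Dart, if d.fst = v then 1 else 0 := by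
    rw [← F.dart_fst_fiber_card_eq_degree v, card_filter, Nat.cast_sum]
    simp
  have ha2 (v) : (F.degree v - a v : ℚ) =
      ∑ d : F.Dart, if d.fst = v then Cᶜ.indicator 1 (.inl d) else 0 := by
    rw [ha1, hdeg, ← sum_sub_distrib]
    refine sum_congr rfl fun d _ => ?_
    by_cases h1 : d.fst = v <;> by_cases h2 : Sum.inl d ∈ C <;> simp [h1, h2]
  have hb1 (v) : (b v : ℚ) = ∑ i : Fin (c v), C.indicator 1 (.inr ⟨v, i⟩) := by
    rw [hb, card_filter, Nat.cast_sum]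
    refine sum_congr rfl fun d _ => ?_
    by_cases h2 : Sum.inr ⟨v, d⟩ ∈ C <;> simp [h2]
  have hb2 (v) : (c v - b v : ℚ) = ∑ i : Fin (c v), Cᶜ.indicator 1 (.inr ⟨v, i⟩) := by
    have : (c v : ℚ) = ∑ i : Fin (c v), 1 := by simp
    rw [hb1, this, ← sum_sub_distrib]
    refine sum_congr rfl fun d _ => ?_
    by_cases h2 : Sum.inr ⟨v, d⟩ ∈ C <;> simp [h2]
  simp only [Fintype.sum_sum_type, sum_add_distrib]
  have e1 : ∑ s : F.Dart, ∑ x : F.Dart, C.indicator 1 (Sum.inl x) * Cᶜ.indicator 1 (Sum.inl s) *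
      gadgetCharge F L c r (.inl s) (.inl x) =
      ∑ d : F.Dart with .inl d ∈ C ∧ .inl d.symm ∉ C, if d.snd ∈ L then 1 else r := by
    rw [sum_comm, sum_filter]
    refine sum_congr rfl fun x _ => ?_
    rw [sum_eq_single x.symm]
    · by_cases h1 : Sum.inl x ∈ C <;> by_cases h2 : Sum.inl x.symm ∈ C <;>
        simp [h1, h2, gadgetCharge]
    · intro s _ hs; simp [gadgetCharge, hs]
    · simp
  have e2 : ∑ s : F.Dart, ∑ x : (Σ v, Fin (c v)),
      C.indicator 1 (Sum.inr x) * Cᶜ.indicator 1 (Sum.inl s) *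
      gadgetCharge F L c r (.inl s) (.inr x) = ∑ v, b v * (F.degree v - a v : ℚ) / F.degree v := by
    rw [sum_comm, Fintype.sum_sigma]
    refine sum_congr rfl fun v _ => ?_
    rw [hb1, ha2, sum_mul_sum, sum_div]
    refine sum_congr rfl fun i _ => ?_
    rw [sum_div]
    refine sum_congr rfl fun d _ => ?_
    by_cases h1 : d.fst = v
    · simp [gadgetCharge, h1]; ring
    · simp [gadgetCharge, h1]
  have e3 : ∑ s : (Σ v, Fin (c v)), ∑ x : F.Dart,
      C.indicator 1 (Sum.inl x) * Cᶜ.indicator 1 (Sum.inr s) *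
      gadgetCharge F L c r (.inr s) (.inl x) = ∑ v, a v * (c v - b v : ℚ) / F.degree v := by
    rw [Fintype.sum_sigma]
    refine sum_congr rfl fun v _ => ?_
    rw [hb2, ha1, mul_comm, sum_mul_sum, sum_div]
    refine sum_congr rfl fun i _ => ?_
    rw [sum_div]
    refine sum_congr rfl fun d _ => ?_
    by_cases h1 : d.fst = v
    · simp [gadgetCharge, h1]; ring
    · simp [gadgetCharge, h1]
  rw [e1, e2, e3]
  simp only [gadgetCharge, mul_zero, sum_const_zero, add_zero, add_div, sum_add_distrib]
  ring

theorem even_card_filter_dart_symm {V : Type*} [Fintype V] (F : SimpleGraph V) [Fintype F.Dart]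
    (P : F.Dart → Prop) [DecidablePred P] : Even #{d : F.Dart | P d ∧ P d.symm} := by
  rw [← ZMod.natCast_eq_zero_iff_even, card_eq_sum_ones, Nat.cast_sum]
  refine sum_involution (fun d _ => d.symm) ?_ ?_ ?_ ?_
  · intro d _; decide
  · intro d _ _; exact d.symm_ne
  · intro d hd
    simp only [mem_filter, mem_univ, true_and, Dart.symm_symm] at hd ⊢
    exact hd.symm
  · intro d _; exact d.symm_symm

open Classical in
/-- If `F` has no single edge between vertices outside `L` forming a cut, then the gadget graph has
a perfect matching. -/
theorem degreeGadget_exists_isPerfectMatching {V : Type*} [Fintype V] (F : SimpleGraph V)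
    (L : Set V) (k q : ℕ) (hk : 0 < k) (hkq : k < q) (hq3 : q ≤ 3 * k) (c : V → ℕ)
    (hc : ∀ v ∉ L, q * c v = (q - k) * F.degree v) (hcL : ∀ v ∈ L, c v = 0)
    (hce : ∀ v, Even (c v))
    (hcross : ∀ A : Set V, ∀ u ∈ A, ∀ v ∉ A, F.Adj u v → u ∉ L → v ∉ L →
      ∃ x ∈ A, ∃ y ∉ A, F.Adj x y ∧ ¬ (x = u ∧ y = v)) :
    ∃ M : (F.degreeGadget L c).Subgraph, M.IsPerfectMatching := by
  have hq : (0 : ℚ) < q := by exact_mod_cast hk.trans hkq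
  have hkqQ : (k : ℚ) < q := by exact_mod_cast hkq
  have hkQ : (0 : ℚ) < k := by exact_mod_cast hk
  have hr0 : (0 : ℚ) ≤ (k : ℚ) / q := by positivity
  have hr1 : (k : ℚ) / q ≤ 1 := by rw [div_le_one hq]; exact hkqQ.le
  have hcdeg (v) (hv : v ∉ L) (hd : F.degree v ≠ 0) :
      (c v : ℚ) * (1 / F.degree v) = (q - k) / q := by
    have := congrArg (Nat.cast (R := ℚ)) (hc v hv)
    push_cast [Nat.cast_sub hkq.le] at this
    have hd' : (F.degree v : ℚ) ≠ 0 := by exact_mod_cast hd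
    field_simp
    linarith
  refine exists_isPerfectMatching_of_charge _ ?_ {x | ∃ a : F.Dart, x = .inl a ∧ a.fst ∈ L} ?_
    (gadgetCharge F L c (k / q)) ?_ ?_ ?_ ?_
  · rw [Fintype.card_sum, Fintype.card_sigma, dart_card_eq_twice_card_edges]
    simp only [Fintype.card_fin]
    refine (even_two_mul _).add (Finset.even_sum _ fun v _ => hce v)
  · rintro _ ⟨a, rfl, ha⟩ _ ⟨b, rfl, hb⟩ hab
    exact Or.inr ⟨fun h => hab (by rw [h]), ha, hb⟩
  · rintro (a | i) (b | j) <;> simp only [gadgetCharge, le_refl] <;> split_ifs <;>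
      positivity
  · rintro (a | i) (b | j) <;> simp only [gadgetCharge, degreeGadget, ne_eq, not_true,
      false_imp_iff] <;> split_ifs with h <;> simp [h]
  · rintro (a | i)
    · rw [Fintype.sum_sum_type, Fintype.sum_sigma]
      rw [sum_eq_single a.symm, sum_eq_single a.fst]
      · have hsum : ∑ i : Fin (c a.fst), gadgetCharge F L c (k / q) (.inl a) (.inr ⟨a.fst, i⟩) =
            c a.fst * (1 / F.degree a.fst) := by
          rw [sum_congr rfl fun i _ => show gadgetCharge F L c (k / q) (.inl a) (.inr ⟨a.fst, i⟩) =
            1 / (F.degree a.fst : ℚ) by simp [gadgetCharge]]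
          simp
        rw [hsum]
        simp only [gadgetCharge, Dart.symm_symm, if_true]
        split_ifs with h
        · simp [hcL _ h]
        · rw [hcdeg _ h]
          · rw [← add_div, add_sub_cancel, div_self hq.ne']
          · rw [← pos_iff_ne_zero, F.degree_pos_iff_exists_adj]
            exact ⟨_, a.adj⟩
      · intro v _ hv
        refine sum_eq_zero fun i _ => ?_
        simp [gadgetCharge, hv.symm]
      · simp
      · intro b _ hb
        have : a ≠ b.symm := fun h => hb (by rw [h, Dart.symm_symm])
        simp [gadgetCharge, this]
      · simp
    · rw [Fintype.sum_sum_type]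
      simp only [gadgetCharge, sum_const_zero, add_zero]
      rw [← sum_filter, sum_const, F.dart_fst_fiber_card_eq_degree, nsmul_eq_mul, mul_one_div]
      exact div_self_le_one _
  · intro C hC hCL
    have hCL' (d : F.Dart) (hd : Sum.inl d ∈ C) : d.fst ∉ L := fun h =>
      Set.disjoint_left.mp hCL hd ⟨d, rfl, h⟩
    let a : V → ℕ := fun v => #{d : F.Dart | d.fst = v ∧ .inl d ∈ C}
    let b : V → ℕ := fun v => #{i : Fin (c v) | .inr ⟨v, i⟩ ∈ C}
    rw [sum_indicator_gadgetCharge F L c (k / q) C a b (fun _ => rfl) (fun _ => rfl)]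
    set t : V → ℚ := fun v => ((a v : ℚ) * (c v - b v) + b v * (F.degree v - a v)) / F.degree v
      with ht
    have hb (v) : b v ≤ c v := (card_filter_le _ _).trans (by simp)
    have ha (v) : a v ≤ F.degree v := by
      rw [← F.dart_fst_fiber_card_eq_degree v]
      refine card_le_card fun d => ?_
      simp only [mem_filter, mem_univ, true_and]
      exact fun h => h.1
    have haL (v) (hv : v ∈ L) : a v = 0 := by
      simp only [a, card_eq_zero, filter_eq_empty_iff]
      rintro d - ⟨rfl, hd⟩
      exact hCL' d hd hv
    have hbL (v) (hv : v ∈ L) : b v = 0 := by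
      have := hb v
      rw [hcL v hv] at this; omega
    have hloc (v) : 0 ≤ t v ∧ (1 ≤ t v ∨ (b v = 0 ∨ b v = c v) ∧
        (((q : ℚ) - k) / q ≤ t v ∨ (b v = 0 ∧ a v = 0) ∨ (b v = c v ∧ a v = F.degree v))) := by
      by_cases hv : v ∈ L
      · simp [ht, haL v hv, hbL v hv]
      · exact charge_local hk hkq (ha v) (hb v) (hc v hv)
    have htsum (v) : t v ≤ ∑ v, t v :=
      single_le_sum (fun v _ => (hloc v).1) (mem_univ v)
    set Γ : Finset F.Dart := {d | .inl d ∈ C ∧ .inl d.symm ∉ C} with hΓ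
    set g : F.Dart → ℚ := fun d => if d.snd ∈ L then 1 else (k : ℚ) / q with hg
    have hgk (d) : (k : ℚ) / q ≤ g d := by
      simp only [hg]; split_ifs
      · exact hr1
      · exact le_rfl
    have hg0 (d) : 0 ≤ g d := hr0.trans (hgk d)
    have hgs : 0 ≤ ∑ d ∈ Γ, g d := sum_nonneg fun d _ => hg0 d
    have hts : 0 ≤ ∑ v, t v := sum_nonneg fun v _ => (hloc v).1
    by_cases hone : ∃ v, 1 ≤ t v
    · obtain ⟨v, hv⟩ := hone
      linarith [htsum v]
    push Not at hone
    have hbc (v) : b v = 0 ∨ b v = c v := ((hloc v).2.resolve_left (hone v).not_ge).1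
    have hbe (v) : Even (b v) := by
      rcases hbc v with h | h
      · simp [h]
      · rw [h]; exact hce v
    have hcardC : C.ncard = #{d : F.Dart | .inl d ∈ C} + ∑ v, b v := by
      rw [Set.ncard_eq_toFinset_card', card_eq_sum_ones]
      have : C.toFinset = ({x | x ∈ C} : Finset _) := by ext; simp
      rw [this, sum_filter, Fintype.sum_sum_type, Fintype.sum_sigma]
      simp only [b, card_filter]
    have hΓodd : Odd #Γ := by
      have h1 : #{d : F.Dart | .inl d ∈ C} =
          #{d : F.Dart | Sum.inl d ∈ C ∧ Sum.inl d.symm ∈ C} + #Γ := by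
        rw [hΓ, ← filter_filter, ← filter_filter, card_filter_add_card_filter_not]
      have h2 : Even #{d : F.Dart | Sum.inl d ∈ C ∧ Sum.inl d.symm ∈ C} :=
        even_card_filter_dart_symm F (fun d => Sum.inl d ∈ C)
      have h3 : Even (∑ v, b v) := Finset.even_sum _ fun v _ => hbe v
      rw [hcardC, h1] at hC
      grind
    have hgΓ : #Γ * ((k : ℚ) / q) ≤ ∑ d ∈ Γ, g d := by
      rw [← nsmul_eq_mul]
      exact card_nsmul_le_sum _ _ _ fun d _ => hgk d
    by_cases h3 : 3 ≤ #Γ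
    · have h3' : (3 : ℚ) ≤ #Γ := by exact_mod_cast h3
      have : (1 : ℚ) ≤ 3 * (k / q) := by
        rw [← mul_div_assoc, le_div_iff₀ hq, one_mul]
        exact_mod_cast hq3
      have := mul_le_mul_of_nonneg_right h3' hr0
      linarith
    have hΓ1 : #Γ = 1 := by grind
    obtain ⟨e, he⟩ := card_eq_one.mp hΓ1
    have heΓ : e ∈ Γ := by rw [he]; simp
    by_cases hsome : ∃ v, ((q : ℚ) - k) / q ≤ t v
    · obtain ⟨v, hv⟩ := hsome
      have h5 : ((q : ℚ) - k) / q + k / q = 1 := by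
        rw [← add_div, sub_add_cancel, div_self hq.ne']
      rw [hΓ1, Nat.cast_one, one_mul] at hgΓ
      linarith [htsum v]
    push Not at hsome
    have hfull (v) : (b v = 0 ∧ a v = 0) ∨ (b v = c v ∧ a v = F.degree v) :=
      ((hloc v).2.resolve_left (hone v).not_ge).2.resolve_left (hsome v).not_ge
    have hmem (d d' : F.Dart) (hd : Sum.inl d ∈ C) (hdd : d'.fst = d.fst) : Sum.inl d' ∈ C := by
      have hpos : a d.fst ≠ 0 := card_ne_zero_of_mem (by simpa using hd : d ∈ _)
      have hfullv := ((hfull d.fst).resolve_left fun h => hpos h.2).2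
      rw [← F.dart_fst_fiber_card_eq_degree d.fst] at hfullv
      have hsub : ({x : F.Dart | x.fst = d.fst ∧ .inl x ∈ C} : Finset _) ⊆
          ({x : F.Dart | x.fst = d.fst} : Finset _) := fun x => by
        simp only [mem_filter, mem_univ, true_and]
        exact fun h => h.1
      have := eq_of_subset_of_card_le hsub hfullv.ge
      have h6 : d' ∈ ({x : F.Dart | x.fst = d.fst} : Finset _) := by simp [hdd]
      rw [← this] at h6
      simp only [mem_filter, mem_univ, true_and] at h6
      exact h6.2
    simp only [hΓ, mem_filter, mem_univ, true_and] at heΓ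
    by_cases heL : e.snd ∈ L
    · have : ∑ d ∈ Γ, g d = 1 := by rw [he, sum_singleton]; simp [hg, heL]
      linarith
    · exfalso
      obtain ⟨x, ⟨d, hdC, rfl⟩, y, hy, hxy, hne⟩ :=
        hcross {v | ∃ d : F.Dart, Sum.inl d ∈ C ∧ d.fst = v} e.fst ⟨e, heΓ.1, rfl⟩ e.snd
          (by rintro ⟨d, hd, hde⟩; exact heΓ.2 (hmem d e.symm hd hde.symm)) e.adj
          (hCL' e heΓ.1) heL
      let f : F.Dart := ⟨(d.fst, y), hxy⟩
      have hf : f ∈ Γ := by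
        simp only [hΓ, mem_filter, mem_univ, true_and]
        exact ⟨hmem d f hdC rfl, fun h => hy ⟨f.symm, h, rfl⟩⟩
      rw [he, mem_singleton] at hf
      exact hne ⟨by rw [← hf], by rw [← hf]⟩

open Classical in
/-- If every cut of `F` through an edge outside `L` has a further edge, then `F` has a subgraph
whose degrees outside `L` are a fixed fraction `k / q` of those of `F`. -/
theorem exists_le_mul_degree_eq {V : Type*} [Fintype V] (F : SimpleGraph V)
    (L : Set V) (k q : ℕ) (hk : 0 < k) (hkq : k < q) (hq3 : q ≤ 3 * k) (hko : Odd k) (hqo : Odd q)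
    (hF : ∀ v ∉ L, q ∣ (F.neighborSet v).ncard)
    (hcross : ∀ A : Set V, ∀ u ∈ A, ∀ v ∉ A, F.Adj u v → u ∉ L → v ∉ L →
      ∃ x ∈ A, ∃ y ∉ A, F.Adj x y ∧ ¬ (x = u ∧ y = v)) :
    ∃ K ≤ F, ∀ v ∉ L, q * (K.neighborSet v).ncard = k * (F.neighborSet v).ncard := by
  simp only [← Nat.card_coe_set_eq, Nat.card_eq_fintype_card, card_neighborSet_eq_degree] at hF ⊢
  let c : V → ℕ := fun v => if v ∈ L then 0 else (q - k) * (F.degree v / q)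
  have hc : ∀ v ∉ L, q * c v = (q - k) * F.degree v := by
    intro v hv
    simp only [c, hv, if_false]
    rw [mul_left_comm, Nat.mul_div_cancel' (hF v hv)]
  obtain ⟨M, hM⟩ := F.degreeGadget_exists_isPerfectMatching L k q hk hkq hq3 c hc
    (fun v hv => by simp [c, hv])
    (fun v => by
      simp only [c]; split_ifs
      · simp
      · exact (Nat.Odd.sub_odd hqo hko).mul_right _)
    hcross
  rw [Subgraph.isPerfectMatching_iff] at hM
  let K : SimpleGraph V :=
    { Adj := fun u v => ∃ h : F.Adj u v, M.Adj (.inl ⟨(u, v), h⟩) (.inl ⟨(v, u), h.symm⟩)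
      symm := ⟨fun u v ⟨h, h'⟩ => ⟨h.symm, h'.symm⟩⟩
      loopless := ⟨fun u ⟨h, _⟩ => h.ne rfl⟩ }
  refine ⟨K, fun u v h => h.1, fun v hv => ?_⟩
  have h1 : K.degree v = #{d : F.Dart | d.fst = v ∧ M.Adj (.inl d) (.inl d.symm)} := by
    rw [← card_neighborFinset_eq_degree]
    refine card_bij (fun u hu => ⟨(v, u), ((mem_neighborFinset _ _ _).mp hu).1⟩) ?_ ?_ ?_
    · intro u hu
      simpa using ((mem_neighborFinset _ _ _).mp hu).2
    · intro u _ w _ h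
      simpa using congrArg (fun d : F.Dart => d.snd) h
    · rintro ⟨⟨x, y⟩, h⟩ hd
      simp only [mem_filter, mem_univ, true_and] at hd
      obtain ⟨rfl, hd⟩ := hd
      exact ⟨y, by simpa using ⟨h, hd⟩, rfl⟩
  have h2 : c v = #{d : F.Dart | d.fst = v ∧ ¬ M.Adj (.inl d) (.inl d.symm)} := by
    have hex (i : Fin (c v)) : ∃ d : F.Dart, d.fst = v ∧ M.Adj (.inr ⟨v, i⟩) (.inl d) := by
      obtain ⟨(d | j), hd, -⟩ := hM (.inr ⟨v, i⟩)
      · exact ⟨d, M.adj_sub hd, hd⟩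
      · exact (M.adj_sub hd).elim
    choose f hfv hf using hex
    rw [← Fintype.card_fin (c v), ← card_univ]
    refine card_bij (fun i _ => f i) ?_ ?_ ?_
    · intro i _
      simp only [mem_filter, mem_univ, true_and]
      refine ⟨hfv i, fun h => ?_⟩
      have := (hM (.inl (f i))).unique h (hf i).symm
      simp at this
    · intro i _ j _ hij
      have h3 := (hf i).symm
      rw [hij] at h3
      have := (hM (.inl (f j))).unique h3 (hf j).symm
      simpa using this
    · rintro d hd
      simp only [mem_filter, mem_univ, true_and] at hd
      obtain ⟨rfl, hd⟩ := hd
      obtain ⟨(e | ⟨w, i⟩), he, -⟩ := hM (.inl d)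
      · rcases M.adj_sub he with h | h
        · have : e = d.symm := by rw [h, Dart.symm_symm]
          rw [this] at he
          exact (hd he).elim
        · exact (hv h.2.1).elim
      · have hw : d.fst = w := M.adj_sub he
        subst hw
        refine ⟨i, mem_univ _, ?_⟩
        have := (hM (.inr ⟨d.fst, i⟩)).unique (hf i) he.symm
        simpa using this
  have h3 : K.degree v + c v = F.degree v := by
    rw [h1, h2, ← F.dart_fst_fiber_card_eq_degree v, ← filter_filter, ← filter_filter,
      card_filter_add_card_filter_not]
  have h4 := hc v hv
  obtain ⟨j, rfl⟩ := Nat.exists_eq_add_of_lt hkq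
  have h5 : k + j + 1 - k = j + 1 := by omega
  rw [← h3, h5] at h4
  calc _ = (k + j + 1) * K.degree v := by congr!
    _ = k * (K.degree v + c v) := by linarith
    _ = _ := by rw [h3]

end SimpleGraph

/-- If every nonempty set of vertices contains a vertex with at most `d` neighbours in it, then the
graph is `d`-degenerate. -/
theorem degenerate_of_forall_exists_ncard_le {V : Type*} [Fintype V] (G : SimpleGraph V)
    (d : ℕ) (h : ∀ Z : Finset V, Z.Nonempty → ∃ v ∈ Z, {u : V | G.Adj v u ∧ u ∈ Z}.ncard ≤ d) :
    Degenerate G d := by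
  classical
  have key : ∀ Z : Finset V, ∃ o : V → ℕ, Set.InjOn o Z ∧ (∀ v ∈ Z, o v < Z.card) ∧
      ∀ v ∈ Z, {u : V | G.Adj v u ∧ u ∈ Z ∧ o u < o v}.ncard ≤ d := by
    intro Z
    induction hn : Z.card generalizing Z with
    | zero =>
      rw [Finset.card_eq_zero] at hn
      subst hn
      exact ⟨fun _ => 0, by simp⟩
    | succ n ih =>
      obtain ⟨v, hvZ, hv⟩ := h Z (Finset.card_pos.mp (by omega))
      have hc : (Z.erase v).card = n := by rw [Finset.card_erase_of_mem hvZ]; omega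
      obtain ⟨o, ho1, ho2, ho3⟩ := ih (Z.erase v) hc
      have hlt (w) (hw : w ∈ Z) (hwv : w ≠ v) : o w < n :=
        ho2 w (Finset.mem_erase.mpr ⟨hwv, hw⟩)
      refine ⟨Function.update o v n, ?_, ?_, ?_⟩
      · intro a ha b hb hab
        by_cases hav : a = v <;> by_cases hbv : b = v
        · rw [hav, hbv]
        · have := hlt b hb hbv
          simp [hav, hbv] at hab; omega
        · have := hlt a ha hav
          simp [hav, hbv] at hab; omega
        · simp only [ne_eq, hav, not_false_eq_true, Function.update_of_ne, hbv] at hab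
          exact ho1 (by simpa [hav] using ha) (by simpa [hbv] using hb) hab
      · intro w hw
        by_cases hwv : w = v
        · simp [hwv]
        · have := hlt w hw hwv
          simp [hwv]; omega
      · intro w hw
        by_cases hwv : w = v
        · subst hwv
          refine le_trans (Set.ncard_le_ncard ?_) hv
          rintro u ⟨h1, h2, -⟩
          exact ⟨h1, h2⟩
        · refine le_trans (Set.ncard_le_ncard ?_) (ho3 w (by simp [hwv, hw]))
          rintro u ⟨h1, h2, h3⟩
          have := hlt w hw hwv
          by_cases huv : u = v
          · subst huv; simp [hwv] at h3; omega
          · simp [huv, hwv] at h3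
            exact ⟨h1, by simp [huv, h2], h3⟩
  obtain ⟨o, ho1, -, ho3⟩ := key Finset.univ
  exact ⟨o, by simpa [Set.injOn_univ] using ho1, by simpa using ho3⟩

open Finset MvPolynomial in
/-- A graph with more than `(p - 1) * #S` edges, all inside `S`, has a nonempty subgraph with all
degrees divisible by the prime `p`. -/
theorem SimpleGraph.exists_prime_dvd_degree {V : Type*} [Fintype V] (F : SimpleGraph V)
    (S : Finset V) (hS : ∀ u v, F.Adj u v → u ∈ S) (p : ℕ) [hp : Fact p.Prime]
    (h : #S * (p - 1) < F.edgeSet.ncard) :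
    ∃ K ≤ F, K ≠ ⊥ ∧ ∀ v, p ∣ (K.neighborSet v).ncard := by
  classical
  let f : V → MvPolynomial F.edgeSet (ZMod p) :=
    fun v => ∑ e ∈ univ.filter (fun e : F.edgeSet => v ∈ (e : Sym2 V)), X e ^ (p - 1)
  have hdeg (v) : (f v).totalDegree ≤ p - 1 := by
    refine totalDegree_finsetSum_le fun e _ => ?_
    simp
  have hsum : ∑ v ∈ S, (f v).totalDegree < Fintype.card F.edgeSet := by
    calc _ ≤ ∑ v ∈ S, (p - 1) := sum_le_sum fun v _ => hdeg v
      _ = #S * (p - 1) := by simp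
      _ < _ := by
        rwa [← Nat.card_eq_fintype_card, Nat.card_coe_set_eq]
  have hdvd := char_dvd_card_solutions_of_sum_lt p hsum
  have hp2 := hp.out.two_le
  have h0 (v) : eval (0 : F.edgeSet → ZMod p) (f v) = 0 := by
    simp only [f, map_sum, map_pow, eval_X, Pi.zero_apply]
    rw [zero_pow (by omega)]; simp
  have : Nonempty { x : F.edgeSet → ZMod p // ∀ i ∈ S, eval x (f i) = 0 } :=
    ⟨⟨0, fun v _ => h0 v⟩⟩
  have hcard : 1 < Fintype.card { x : F.edgeSet → ZMod p // ∀ i ∈ S, eval x (f i) = 0 } :=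
    lt_of_lt_of_le hp.out.one_lt (Nat.le_of_dvd Fintype.card_pos (by convert hdvd))
  obtain ⟨⟨x, hx⟩, hne⟩ := Fintype.exists_ne_of_one_lt_card hcard ⟨0, fun v _ => h0 v⟩
  have hx0 : x ≠ 0 := fun h => hne (Subtype.ext h)
  let K : SimpleGraph V :=
    { Adj := fun u v => ∃ h : F.Adj u v, x ⟨s(u, v), h⟩ ≠ 0
      symm := ⟨by
        rintro u v ⟨h, h'⟩
        refine ⟨h.symm, ?_⟩
        convert h' using 3
        exact Subtype.ext Sym2.eq_swap⟩
      loopless := ⟨by rintro u ⟨h, -⟩; exact h.ne rfl⟩ }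
  refine ⟨K, fun u v h => h.1, ?_, ?_⟩
  · obtain ⟨⟨e, he⟩, hxe⟩ := Function.ne_iff.mp hx0
    induction e with
    | h u v =>
      intro hK
      have : K.Adj u v := ⟨he, hxe⟩
      rw [hK] at this; exact this
  · intro v
    by_cases hv : v ∈ S
    · have := hx v hv
      simp only [f, map_sum, map_pow, eval_X] at this
      have h1 : ∀ e : F.edgeSet, x e ^ (p - 1) = if x e ≠ 0 then 1 else 0 := by
        intro e
        split_ifs with h
        · exact ZMod.pow_card_sub_one_eq_one h
        · rw [not_not.mp h, zero_pow (by omega)]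
      simp_rw [h1] at this
      rw [← sum_filter, sum_const, nsmul_eq_mul, mul_one, ZMod.natCast_eq_zero_iff,
        filter_filter] at this
      convert this using 1
      symm
      rw [← Set.ncard_coe_finset]
      refine (Set.ncard_congr (fun u hu => (⟨s(v, u), hu.1⟩ : F.edgeSet)) ?_ ?_ ?_).symm
      · rintro u ⟨h1, h2⟩
        simp [h2]
      · intro a b ha hb hab
        have := congrArg Subtype.val hab
        simp only [Sym2.eq_iff, true_and] at this
        rcases this with h | ⟨h1, h2⟩
        · exact h
        · exact h2.trans h1
      · rintro ⟨e, he⟩ h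
        induction e with
        | h a b =>
          simp only [ne_eq, coe_filter, mem_univ, Sym2.mem_iff, true_and, Set.mem_ofPred_eq] at h
          obtain ⟨rfl | rfl, h2⟩ := h
          · exact ⟨b, ⟨he, h2⟩, rfl⟩
          · refine ⟨a, ⟨he.symm, ?_⟩, ?_⟩
            · convert h2 using 3; exact Subtype.ext Sym2.eq_swap
            · exact Subtype.ext Sym2.eq_swap
    · have : K.neighborSet v = ∅ := by
        ext u
        simp only [mem_neighborSet, Set.mem_empty_iff_false, iff_false]
        rintro ⟨h, -⟩
        exact hv (hS _ _ h)
      simp [this]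

namespace SimpleGraph

/-- The graph `F` restricted to `A`, together with the edge `uv` if it belongs to `F`. -/
def inducedWithEdge {V : Type*} (F : SimpleGraph V) (A : Set V) (u v : V) : SimpleGraph V where
  Adj x y := F.Adj x y ∧ ((x ∈ A ∧ y ∈ A) ∨ (x = u ∧ y = v) ∨ (x = v ∧ y = u))
  symm := ⟨fun x y h => ⟨h.1.symm, by tauto⟩⟩
  loopless := ⟨fun x h => h.1.ne rfl⟩

/-- If `uv` is the only edge of `F` leaving `A`, then passing to `F.inducedWithEdge A u v` preserves
divisibility of the degrees at all vertices other than `v`. -/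
theorem dvd_inducedWithEdge {V : Type*} (F : SimpleGraph V) (A : Set V)
    {u v : V} (hu : u ∈ A) (hv : v ∉ A)
    (h : ∀ x ∈ A, ∀ y ∉ A, F.Adj x y → x = u ∧ y = v) {w : V} (hw : w ≠ v) {q : ℕ}
    (hq : q ∣ (F.neighborSet w).ncard) :
    q ∣ ((F.inducedWithEdge A u v).neighborSet w).ncard := by
  by_cases hwA : w ∈ A
  · convert hq using 2
    ext y
    simp only [mem_neighborSet, inducedWithEdge, and_iff_left_iff_imp]
    intro hy
    by_cases hyA : y ∈ A
    · exact Or.inl ⟨hwA, hyA⟩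
    · exact Or.inr (Or.inl (h w hwA y hyA hy))
  · have : (F.inducedWithEdge A u v).neighborSet w = ∅ := by
      ext y
      simp only [mem_neighborSet, inducedWithEdge, Set.mem_empty_iff_false, iff_false]
      rintro ⟨-, ⟨h1, -⟩ | ⟨rfl, -⟩ | ⟨rfl, -⟩⟩
      exacts [hwA h1, hwA hu, hw rfl]
    simp [this]

theorem ncard_edgeSet_inducedWithEdge_lt {V : Type*} [Finite V] (F : SimpleGraph V) (A : Set V)
    {u v : V} (hv : v ∉ A) (hvd : 1 < (F.neighborSet v).ncard) :
    (F.inducedWithEdge A u v).edgeSet.ncard < F.edgeSet.ncard := by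
  obtain ⟨y, hy, hyu⟩ := Set.exists_ne_of_one_lt_ncard hvd u
  refine Set.ncard_lt_ncard (edgeSet_ssubset_edgeSet.mpr (lt_of_le_not_ge (fun _ _ h => h.1) ?_))
    (Set.toFinite _)
  intro hle
  obtain ⟨-, ⟨h1, -⟩ | ⟨rfl, rfl⟩ | ⟨-, h1⟩⟩ := hle hy
  exacts [hv h1, hy.ne rfl, hyu h1]

/-- A nonempty graph with degrees outside `L` divisible by an odd number `q` has, for every odd `k`
with `k < q ≤ 3 * k`, a nonempty subgraph with degrees outside `L` divisible by `k`. -/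
theorem exists_le_dvd_degree_of_dvd_degree {V : Type*} [Fintype V] (F : SimpleGraph V) (L : Set V)
    (k q : ℕ) (hk : 0 < k) (hkq : k < q) (hq3 : q ≤ 3 * k) (hko : Odd k) (hqo : Odd q)
    (hF : ∀ v ∉ L, q ∣ (F.neighborSet v).ncard) (hne : F ≠ ⊥) :
    ∃ K ≤ F, K ≠ ⊥ ∧ ∀ v ∉ L, k ∣ (K.neighborSet v).ncard := by
  induction hn : F.edgeSet.ncard using Nat.strong_induction_on generalizing F L with
  | _ n ih =>
  subst hn
  have hpos {v w : V} (hvw : F.Adj v w) : 0 < (F.neighborSet v).ncard :=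
    (Set.ncard_pos (Set.toFinite _)).mpr ⟨w, hvw⟩
  by_cases hLL : ∃ u ∈ L, ∃ v ∈ L, F.Adj u v
  · obtain ⟨u, hu, v, hv, huv⟩ := hLL
    refine ⟨edge u v, ?_, ?_, fun w hw => ?_⟩
    · intro x y hxy
      obtain ⟨⟨rfl, rfl⟩ | ⟨rfl, rfl⟩, -⟩ := (edge_adj ..).mp hxy
      exacts [huv, huv.symm]
    · intro h
      have : (edge u v).Adj u v := by simp [edge_adj, huv.ne]
      rw [h] at this
      exact this
    · have : (edge u v).neighborSet w = ∅ := by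
        ext y
        simp only [mem_neighborSet, edge_adj, Set.mem_empty_iff_false, iff_false]
        rintro ⟨⟨rfl, -⟩ | ⟨rfl, -⟩, -⟩
        exacts [hw hu, hw hv]
      simp [this]
  by_cases hcross : ∀ A : Set V, ∀ u ∈ A, ∀ v ∉ A, F.Adj u v → u ∉ L → v ∉ L →
      ∃ x ∈ A, ∃ y ∉ A, F.Adj x y ∧ ¬ (x = u ∧ y = v)
  · obtain ⟨K, hKF, hK⟩ := exists_le_mul_degree_eq F L k q hk hkq hq3 hko hqo hF hcross
    refine ⟨K, hKF, ?_, fun v hv => ?_⟩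
    · rintro rfl
      obtain ⟨u, v, huv⟩ := ne_bot_iff_exists_adj.mp hne
      have h0 (w : V) (hw : w ∉ L) : ¬ 0 < (F.neighborSet w).ncard := by
        have := hK w hw
        have h2 : (⊥ : SimpleGraph V).neighborSet w = ∅ := by ext; simp
        rw [h2, Set.ncard_empty, mul_zero, eq_comm, mul_eq_zero] at this
        omega
      by_cases hu : u ∈ L
      · exact h0 v (fun hv => hLL ⟨u, hu, v, hv, huv⟩) (hpos huv.symm)
      · exact h0 u hu (hpos huv)
    · obtain ⟨m, hm⟩ := hF v hv
      have := hK v hv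
      rw [hm, mul_left_comm] at this
      exact ⟨m, Nat.eq_of_mul_eq_mul_left (hk.trans hkq) this⟩
  push Not at hcross
  obtain ⟨A, u, hu, v, hv, huv, huL, hvL, hA⟩ := hcross
  have half (B : Set V) (a b : V) (ha : a ∈ B) (hb : b ∉ B) (hab : F.Adj a b) (hbL : b ∉ L)
      (hB : ∀ x ∈ B, ∀ y ∉ B, F.Adj x y → x = a ∧ y = b) :
      ∃ K ≤ F.inducedWithEdge B a b, K ≠ ⊥ ∧ ∀ w ∉ L, w ≠ b → k ∣ (K.neighborSet w).ncard := by
    have h1 := Nat.le_of_dvd (hpos hab.symm) (hF b hbL)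
    obtain ⟨K, hK1, hK2, hK3⟩ := ih _ (ncard_edgeSet_inducedWithEdge_lt F B (u := a) hb (by omega))
      (F.inducedWithEdge B a b) (insert b L)
      (fun w hw => dvd_inducedWithEdge F B ha hb hB (fun h => hw (Or.inl h))
        (hF w fun h => hw (Or.inr h)))
      (ne_bot_iff_exists_adj.mpr ⟨a, b, hab, by simp⟩) rfl
    exact ⟨K, hK1, hK2, fun w hw hwb => hK3 w (by simp [hw, hwb])⟩
  obtain ⟨K₁, hK₁, hne₁, hd₁⟩ := half A u v hu hv huv hvL hA
  obtain ⟨K₂, hK₂, hne₂, hd₂⟩ := half Aᶜ v u hv (by simpa using hu) huv.symm huL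
    (fun x hx y hy hxy => (hA y (by simpa using hy) x hx hxy.symm).symm)
  have hle₁ : K₁ ≤ F := fun _ _ h => (hK₁ h).1
  have hle₂ : K₂ ≤ F := fun _ _ h => (hK₂ h).1
  by_cases h₁ : K₁.Adj u v
  swap
  · refine ⟨K₁, hle₁, hne₁, fun w hw => ?_⟩
    by_cases hwv : w = v
    · have : K₁.neighborSet w = ∅ := by
        ext y
        simp only [mem_neighborSet, Set.mem_empty_iff_false, iff_false]
        intro hy
        subst hwv
        obtain ⟨-, ⟨h3, -⟩ | ⟨rfl, rfl⟩ | ⟨-, rfl⟩⟩ := hK₁ hy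
        exacts [hv h3, hy.ne rfl, h₁ hy.symm]
      simp [this]
    · exact hd₁ w hw hwv
  by_cases h₂ : K₂.Adj v u
  swap
  · refine ⟨K₂, hle₂, hne₂, fun w hw => ?_⟩
    by_cases hwu : w = u
    · have : K₂.neighborSet w = ∅ := by
        ext y
        simp only [mem_neighborSet, Set.mem_empty_iff_false, iff_false]
        intro hy
        subst hwu
        obtain ⟨-, ⟨h3, -⟩ | ⟨rfl, rfl⟩ | ⟨-, rfl⟩⟩ := hK₂ hy
        exacts [h3 hu, hy.ne rfl, h₂ hy.symm]
      simp [this]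
    · exact hd₂ w hw hwu
  refine ⟨K₁ ⊔ K₂, sup_le hle₁ hle₂, fun h => hne₁ (le_bot_iff.mp (h ▸ le_sup_left)),
    fun w hw => ?_⟩
  by_cases hwA : w ∈ A
  · convert hd₁ w hw (fun h => hv (h ▸ hwA)) using 2
    ext y
    simp only [mem_neighborSet, sup_adj, or_iff_left_iff_imp]
    intro hy
    obtain ⟨-, ⟨h3, -⟩ | ⟨rfl, rfl⟩ | ⟨rfl, rfl⟩⟩ := hK₂ hy
    exacts [(h3 hwA).elim, (hv hwA).elim, h₁]
  · convert hd₂ w hw (fun h => hwA (h ▸ hu)) using 2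
    ext y
    simp only [mem_neighborSet, sup_adj, or_iff_right_iff_imp]
    intro hy
    obtain ⟨-, ⟨h3, -⟩ | ⟨rfl, rfl⟩ | ⟨rfl, rfl⟩⟩ := hK₁ hy
    exacts [(hwA h3).elim, (hwA hu).elim, h₂]

end SimpleGraph

theorem prime_q (m : ℕ) : (q m).Prime :=
  (Nat.sInf_mem (s := {p : ℕ | p.Prime ∧ m ≤ p})
    ((Nat.exists_infinite_primes m).imp fun _ h => h.symm)).1

theorem le_q (m : ℕ) : m ≤ q m :=
  (Nat.sInf_mem (s := {p : ℕ | p.Prime ∧ m ≤ p})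
    ((Nat.exists_infinite_primes m).imp fun _ h => h.symm)).2

theorem q_le_two_mul {m : ℕ} (hm : m ≠ 0) : q m ≤ 2 * m := by
  obtain ⟨p, hp, h1, h2⟩ := Nat.exists_prime_lt_and_le_two_mul m hm
  exact (Nat.sInf_le (s := {p : ℕ | p.Prime ∧ m ≤ p}) ⟨hp, h1.le⟩).trans h2

/-- A maximum subgraph with degrees `1` modulo `k` admits no edge-disjoint extension. -/
theorem IsMaxMod1Subgraph.eq_bot_of_le_sdiff {V : Type*} [Finite V] {k : ℕ} {G H K : SimpleGraph V}
    (hH : IsMaxMod1Subgraph k G H) (hK : K ≤ G \ H)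
    (hd : ∀ v ∈ K.support, ((H ⊔ K).neighborSet v).ncard % k = 1) : K = ⊥ := by
  by_contra hne
  obtain ⟨a, b, hab⟩ := SimpleGraph.ne_bot_iff_exists_adj.mp hne
  have hmod : IsMod1Subgraph k G (H ⊔ K) := by
    refine ⟨sup_le hH.1.1 (hK.trans sdiff_le), fun v hv => ?_⟩
    by_cases hvK : v ∈ K.support
    · exact hd v hvK
    · obtain ⟨w, hw⟩ := hv
      have hwH : H.Adj v w := hw.resolve_right fun h => hvK ⟨w, h⟩
      rw [← hH.1.2 v ⟨w, hwH⟩]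
      congr 2
      ext u
      exact or_iff_left fun h => hvK ⟨u, h⟩
  refine (hH.2 _ hmod).not_gt (Set.ncard_lt_ncard (SimpleGraph.edgeSet_ssubset_edgeSet.mpr
    (lt_of_le_not_ge le_sup_left fun hle => ?_)) (Set.toFinite _))
  exact (hK hab).2 (hle (Or.inr hab))

theorem ncard_neighborSet_sup_of_le_sdiff {V : Type*} [Finite V] {G H K : SimpleGraph V}
    (hK : K ≤ G \ H) (v : V) :
    ((H ⊔ K).neighborSet v).ncard = (H.neighborSet v).ncard + (K.neighborSet v).ncard := by
  rw [← Set.ncard_union_eq _ (Set.toFinite _) (Set.toFinite _)]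
  · rfl
  · rw [Set.disjoint_left]
    exact fun u h1 h2 => (hK h2).2 h1

/-- The star with centre `w` and leaf set `T`. -/
def starGraph {V : Type*} (w : V) (T : Set V) (hw : w ∉ T) : SimpleGraph V where
  Adj x y := (x = w ∧ y ∈ T) ∨ (y = w ∧ x ∈ T)
  symm := ⟨fun _ _ h => h.symm⟩
  loopless := ⟨by rintro x (⟨rfl, h⟩ | ⟨rfl, h⟩) <;> exact hw h⟩

/-- Adding a star whose leaves are isolated in `H` to a maximum subgraph `H` cannot make
the degree of the centre congruent to `1`. -/
theorem IsMaxMod1Subgraph.ncard_add_mod_ne_one {V : Type*} [Finite V] {k : ℕ} (hk : 1 < k)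
    {G H : SimpleGraph V} (hH : IsMaxMod1Subgraph k G H) (w : V) {T : Set V}
    (hT : ∀ u ∈ T, (G \ H).Adj w u ∧ u ∉ H.support) (hne : T.Nonempty) :
    ((H.neighborSet w).ncard + T.ncard) % k ≠ 1 := by
  intro hmod
  have hw : w ∉ T := fun h => (hT w h).1.ne rfl
  obtain ⟨t, ht⟩ := hne
  have hle : starGraph w T hw ≤ G \ H := by
    rintro x y (⟨rfl, h⟩ | ⟨rfl, h⟩)
    exacts [(hT y h).1, (hT x h).1.symm]
  have hbot := hH.eq_bot_of_le_sdiff hle fun v hv => by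
    rw [ncard_neighborSet_sup_of_le_sdiff hle]
    by_cases hvw : v = w
    · subst hvw
      convert hmod using 4
      ext u
      simp only [SimpleGraph.mem_neighborSet, starGraph, true_and, hw, and_false, or_false]
    · obtain ⟨x, ⟨h, -⟩ | ⟨-, hvT⟩⟩ := hv
      · exact (hvw h).elim
      have h1 : H.neighborSet v = ∅ := by
        ext u
        simp only [SimpleGraph.mem_neighborSet, Set.mem_empty_iff_false, iff_false]
        exact fun h => (hT v hvT).2 ⟨u, h⟩
      have h2 : (starGraph w T hw).neighborSet v = {w} := by
        ext u
        simp [starGraph, hvw, hvT]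
      rw [h1, h2, Set.ncard_empty, Set.ncard_singleton, zero_add, Nat.mod_eq_of_lt hk]
  have : (starGraph w T hw).Adj w t := Or.inl ⟨rfl, ht⟩
  rw [hbot] at this
  exact this

/-- In the complement of a maximum subgraph, at most `k - 1` neighbours of a covered vertex
are uncovered. -/
theorem IsMaxMod1Subgraph.ncard_neighborSet_sdiff_support_lt {V : Type*} [Finite V] {k : ℕ}
    (hk : 1 < k) {G H : SimpleGraph V} (hH : IsMaxMod1Subgraph k G H) {w : V}
    (hw : w ∈ H.support) : {u | (G \ H).Adj w u ∧ u ∉ H.support}.ncard < k := by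
  by_contra! hle
  obtain ⟨T, hT, hTk⟩ := Set.exists_subset_card_eq hle
  refine hH.ncard_add_mod_ne_one hk w hT (Set.nonempty_of_ncard_ne_zero (by omega)) ?_
  rw [hTk, Nat.add_mod_right]
  exact hH.1.2 w hw

/-- The vertices not covered by a maximum subgraph are independent. -/
theorem IsMaxMod1Subgraph.mem_support_of_adj {V : Type*} [Finite V] {k : ℕ}
    (hk : 1 < k) {G H : SimpleGraph V} (hH : IsMaxMod1Subgraph k G H) {v u : V}
    (hvu : (G \ H).Adj v u) (hv : v ∉ H.support) : u ∈ H.support := by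
  by_contra hu
  refine hH.ncard_add_mod_ne_one hk v (T := {u})
    (fun x hx => by rw [Set.mem_singleton_iff.mp hx]; exact ⟨hvu, hu⟩) ⟨u, rfl⟩ ?_
  have h1 : H.neighborSet v = ∅ := by
    ext x
    simp only [SimpleGraph.mem_neighborSet, Set.mem_empty_iff_false, iff_false]
    exact fun h => hv ⟨x, h⟩
  rw [h1, Set.ncard_empty, Set.ncard_singleton, zero_add, Nat.mod_eq_of_lt hk]

/-- A graph with minimum degree at least `2 * q k - 1` on a nonempty vertex set has a nonempty
subgraph with all degrees divisible by `k`. -/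
theorem SimpleGraph.exists_le_dvd_degree_of_le_degree {V : Type*} [Fintype V] {k : ℕ}
    (hk : 3 ≤ k) (hkodd : Odd k) (F : SimpleGraph V) (S : Finset V) (hne : S.Nonempty)
    (hS : ∀ u v, F.Adj u v → u ∈ S) (hd : ∀ v ∈ S, 2 * q k - 1 ≤ (F.neighborSet v).ncard) :
    ∃ K ≤ F, K ≠ ⊥ ∧ ∀ v, k ∣ (K.neighborSet v).ncard := by
  classical
  have hqp := prime_q k
  have hkq := le_q k
  have : Fact (q k).Prime := ⟨hqp⟩
  have hcard : S.card * (q k - 1) < F.edgeSet.ncard := by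
    have h1 := F.sum_degrees_eq_twice_card_edges
    have h2 : S.card * (2 * q k - 1) ≤ ∑ v, F.degree v := by
      rw [← smul_eq_mul]
      refine (Finset.card_nsmul_le_sum S (fun v => F.degree v) _ fun v hv => ?_).trans
        (Finset.sum_le_sum_of_subset (Finset.subset_univ _))
      refine (hd v hv).trans_eq ?_
      rw [← F.card_neighborSet_eq_degree, ← Nat.card_eq_fintype_card, Nat.card_coe_set_eq]
    have h3 : F.edgeSet.ncard = F.edgeFinset.card := by
      rw [← SimpleGraph.coe_edgeFinset, Set.ncard_coe_finset]
    rw [h1, ← h3] at h2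
    obtain ⟨r, hr⟩ : ∃ r, q k = r + 1 := ⟨q k - 1, by omega⟩
    rw [hr] at h2 ⊢
    have h4 : 2 * (r + 1) - 1 = 2 * r + 1 := by omega
    rw [h4] at h2
    have := hne.card_pos
    simp only [add_tsub_cancel_right]
    nlinarith
  obtain ⟨K, hKF, hK, hKd⟩ := F.exists_prime_dvd_degree S hS (q k) hcard
  obtain heq | hlt := hkq.eq_or_lt
  · exact ⟨K, hKF, hK, fun v => heq.symm ▸ hKd v⟩
  · have h2 := q_le_two_mul (m := k) (by omega)
    obtain ⟨K', hK', hne', hd'⟩ := K.exists_le_dvd_degree_of_dvd_degree ∅ k (q k) (by omega) hlt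
      (by omega) hkodd (hqp.odd_of_ne_two (by omega)) (fun v _ => hKd v) hK
    exact ⟨K', hK'.trans hKF, hne', fun v => hd' v (Set.notMem_empty v)⟩

theorem statement15 (k : ℕ) (hk : 3 ≤ k) (hkodd : Odd k)
    (V : Type) [Fintype V] (G H : SimpleGraph V) (hH : IsMaxMod1Subgraph k G H) :
    Degenerate (G \ H) (2 * q k + k - 3) := by
  classical
  refine degenerate_of_forall_exists_ncard_le _ _ fun Z hZ => ?_
  by_contra! hdeg
  have hkq := le_q k
  let S : Finset V := {v ∈ Z | v ∈ H.support}
  have hSne : S.Nonempty := by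
    obtain ⟨v, hv⟩ := hZ
    by_cases hvH : v ∈ H.support
    · exact ⟨v, by simp [S, hv, hvH]⟩
    · obtain ⟨u, hu, huZ⟩ := Set.nonempty_of_ncard_ne_zero (Nat.ne_zero_of_lt (hdeg v hv))
      exact ⟨u, by simp [S, huZ, hH.mem_support_of_adj (by omega) hu hvH]⟩
  let F : SimpleGraph V :=
    { Adj := fun x y => (G \ H).Adj x y ∧ x ∈ S ∧ y ∈ S
      symm := ⟨fun _ _ h => ⟨h.1.symm, h.2.2, h.2.1⟩⟩
      loopless := ⟨fun _ h => h.1.ne rfl⟩ }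
  obtain ⟨K, hKF, hK, hKd⟩ := F.exists_le_dvd_degree_of_le_degree hk hkodd S hSne
    (fun _ _ h => h.2.1) fun v hv => by
      have hvZ := Finset.mem_filter.mp hv
      have h1 := hdeg v hvZ.1
      have h2 := hH.ncard_neighborSet_sdiff_support_lt (by omega) hvZ.2
      have h3 : {u | (G \ H).Adj v u ∧ u ∈ Z} ⊆
          F.neighborSet v ∪ {u | (G \ H).Adj v u ∧ u ∉ H.support} := by
        rintro u ⟨hu, huZ⟩
        by_cases huH : u ∈ H.support
        · exact Or.inl ⟨hu, hv, by simp [S, huZ, huH]⟩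
        · exact Or.inr ⟨hu, huH⟩
      have h4 := (Set.ncard_le_ncard h3 (Set.toFinite _)).trans (Set.ncard_union_le _ _)
      omega
  have hKG : K ≤ G \ H := fun _ _ h => (hKF h).1
  refine hK (hH.eq_bot_of_le_sdiff hKG fun v hv => ?_)
  obtain ⟨u, hu⟩ := hv
  obtain ⟨m, hm⟩ := hKd v
  rw [ncard_neighborSet_sup_of_le_sdiff hKG, hm, Nat.add_mul_mod_self_left]
  exact hH.1.2 v (Finset.mem_filter.mp (hKF hu).2.1).2
end

section
/- Let k be a prime power. If G is a finite simple graph on n vertices that does not contain any non-empty k-divisible subgraph, then the number of edges of G satisfies e(G) ≤ (k − 1)·n. -/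
open Finset in
/-- The functions on subsets of `E` that are given by a multilinear polynomial of degree at most `d`
in the indicator variables of the elements of `E`. -/
def lowDegree (R E : Type*) [CommRing R] [DecidableEq E] (d : ℕ) :
    Submodule R (Finset E → R) :=
  Submodule.span R {f | ∃ T : Finset E, #T ≤ d ∧ f = fun S => if T ⊆ S then 1 else 0}

section LowDegree

open Finset

variable {R E : Type*} [CommRing R] [DecidableEq E]

theorem ite_subset_mem_lowDegree {d : ℕ} {T : Finset E} (hT : #T ≤ d) :
    (fun S => if T ⊆ S then (1 : R) else 0) ∈ lowDegree R E d :=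
  Submodule.subset_span ⟨T, hT, rfl⟩

theorem lowDegree_mono {a b : ℕ} (h : a ≤ b) : lowDegree R E a ≤ lowDegree R E b :=
  Submodule.span_mono fun _ ⟨T, hT, hf⟩ => ⟨T, hT.trans h, hf⟩

theorem mul_mem_lowDegree {a b : ℕ} {f g : Finset E → R} (hf : f ∈ lowDegree R E a)
    (hg : g ∈ lowDegree R E b) : f * g ∈ lowDegree R E (a + b) := by
  have h := Submodule.mul_mem_mul hf hg
  rw [lowDegree, lowDegree, Submodule.span_mul_span] at h
  refine Submodule.span_le.2 ?_ h
  rintro _ ⟨_, ⟨T, hT, rfl⟩, _, ⟨T', hT', rfl⟩, rfl⟩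
  rw [SetLike.mem_coe]
  convert ite_subset_mem_lowDegree (R := R)
    ((card_union_le T T').trans (add_le_add hT hT')) using 1
  ext S
  simp only [Pi.mul_apply, union_subset_iff]
  split_ifs <;> simp_all

theorem prod_mem_lowDegree {ι : Type*} (s : Finset ι) {d : ℕ} {f : ι → Finset E → R}
    (hf : ∀ i, f i ∈ lowDegree R E d) : ∏ i ∈ s, f i ∈ lowDegree R E (d * #s) := by
  classical
  induction s using Finset.induction_on with
  | empty =>
    convert ite_subset_mem_lowDegree (R := R) (T := (∅ : Finset E)) (Nat.zero_le _) using 1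
    ext S
    simp
  | insert i s hi ih =>
    rw [prod_insert hi, card_insert_of_notMem hi, mul_add_one, add_comm]
    exact mul_mem_lowDegree (hf i) ih

theorem choose_card_inter_mem_lowDegree (A : Finset E) (j : ℕ) :
    (fun S => ((#(A ∩ S)).choose j : R)) ∈ lowDegree R E j := by
  have h : (fun S => ((#(A ∩ S)).choose j : R)) =
      ∑ T ∈ A.powersetCard j, fun S => if T ⊆ S then (1 : R) else 0 := by
    ext S
    rw [Finset.sum_apply, sum_boole, ← card_powersetCard]
    congr 2
    ext T
    simp only [mem_powersetCard, mem_filter, subset_inter_iff]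
    tauto
  rw [h]
  exact sum_mem fun T hT => ite_subset_mem_lowDegree (mem_powersetCard.1 hT).2.le

theorem choose_card_inter_add_mem_lowDegree (A : Finset E) (m j : ℕ) :
    (fun S => ((#(A ∩ S) + m).choose j : R)) ∈ lowDegree R E j := by
  have h : (fun S => ((#(A ∩ S) + m).choose j : R)) =
      ∑ ij ∈ antidiagonal j, (m.choose ij.2 : R) • fun S => ((#(A ∩ S)).choose ij.1 : R) := by
    ext S
    simp [Nat.add_choose_eq, mul_comm]
  rw [h]
  exact sum_mem fun ij hij => Submodule.smul_mem _ _ <|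
    lowDegree_mono (HasAntidiagonal.antidiagonal.fst_le hij) (choose_card_inter_mem_lowDegree A _)

theorem sum_neg_one_pow_card_mul_ite_subset [Fintype E] {T : Finset E} (hT : T ≠ univ) :
    ∑ S : Finset E, (-1 : R) ^ #S * (if T ⊆ S then 1 else 0) = 0 := by
  obtain ⟨e, he⟩ : ∃ e, e ∉ T := by
    by_contra! h
    exact hT (eq_univ_of_forall h)
  refine sum_involution (fun S _ => symmDiff S {e}) ?_ ?_ (by simp) (by simp)
  · intro S _
    by_cases heS : e ∈ S
    · have h1 : symmDiff S {e} = S.erase e := by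
        ext x
        by_cases hx : x = e <;> simp [mem_symmDiff, hx, heS]
      have h2 : T ⊆ S.erase e ↔ T ⊆ S := by
        simp [subset_erase, he]
      rw [h1, ← card_erase_add_one heS]
      simp only [h2]
      ring
    · have h1 : symmDiff S {e} = insert e S := by
        ext x
        by_cases hx : x = e <;> simp [mem_symmDiff, hx, heS]
      have h2 : T ⊆ insert e S ↔ T ⊆ S := subset_insert_iff_of_notMem he
      rw [h1, card_insert_of_notMem heS]
      simp only [h2]
      ring
  · intro S _ _ h
    have := congrArg (e ∈ ·) h
    by_cases heS : e ∈ S <;> simp [mem_symmDiff, heS] at this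

theorem sum_neg_one_pow_card_mul_eq_zero [Fintype E] {d : ℕ} (hd : d < Fintype.card E)
    {f : Finset E → R} (hf : f ∈ lowDegree R E d) :
    ∑ S : Finset E, (-1 : R) ^ #S * f S = 0 := by
  induction hf using Submodule.span_induction with
  | mem f hf =>
    obtain ⟨T, hT, rfl⟩ := hf
    refine sum_neg_one_pow_card_mul_ite_subset fun h => ?_
    rw [h, card_univ] at hT
    omega
  | zero => simp
  | add f g _ _ hf hg => simp [mul_add, sum_add_distrib, hf, hg]
  | smul a f _ hf => simp [mul_left_comm _ a, ← mul_sum, hf]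

end LowDegree

theorem Nat.Prime.dvd_choose_add_sub_one {p m d : ℕ} (hp : p.Prime) (hd : ¬ p ^ m ∣ d) :
    p ∣ (d + (p ^ m - 1)).choose (p ^ m - 1) := by
  by_contra h
  have hpos : 0 < p ^ m := pow_pos hp.pos m
  have key := Nat.choose_succ_right_eq (d + (p ^ m - 1)) (p ^ m - 1)
  rw [Nat.sub_add_cancel hpos, Nat.add_sub_cancel] at key
  have hcop : (p ^ m).Coprime ((d + (p ^ m - 1)).choose (p ^ m - 1)) :=
    Nat.Coprime.pow_left m ((Nat.Prime.coprime_iff_not_dvd hp).2 h)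
  exact hd (hcop.dvd_of_dvd_mul_left (key ▸ Dvd.intro_left _ rfl))

open Finset in
/-- If `k` is a prime power and a ground set has more than `(k - 1) * n` elements, then for any `n`
subsets some non-empty set meets all of them in a multiple of `k` elements. -/
theorem exists_nonempty_forall_dvd_card_inter {E V : Type*} [Fintype E] [DecidableEq E] [Fintype V]
    {k : ℕ} (hk : IsPrimePow k) (A : V → Finset E)
    (h : (k - 1) * Fintype.card V < Fintype.card E) :
    ∃ S : Finset E, S.Nonempty ∧ ∀ v, k ∣ #(A v ∩ S) := by
  obtain ⟨p, m, hp, -, rfl⟩ := (isPrimePow_nat_iff k).1 hk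
  have := Fact.mk hp
  by_contra! hS
  have hsum := sum_neg_one_pow_card_mul_eq_zero h
    (prod_mem_lowDegree univ fun v =>
      choose_card_inter_add_mem_lowDegree (R := ZMod p) (A v) (p ^ m - 1) (p ^ m - 1))
  rw [sum_eq_single ∅] at hsum
  · simp at hsum
  · intro S _ hne
    obtain ⟨v, hv⟩ := hS S (nonempty_iff_ne_empty.2 hne)
    rw [prod_apply, prod_eq_zero (mem_univ v), mul_zero]
    exact (ZMod.natCast_eq_zero_iff _ _).2 (hp.dvd_choose_add_sub_one hv)
  · simp

theorem SimpleGraph.ncard_setOf_adj_eq_ncard_edgeSet {V : Type*} (H : SimpleGraph V) (v : V) :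
    {u : V | H.Adj v u}.ncard = {e ∈ H.edgeSet | v ∈ e}.ncard := by
  have h : {e ∈ H.edgeSet | v ∈ e} = (fun u => s(v, u)) '' {u : V | H.Adj v u} := by
    ext e
    constructor
    · rintro ⟨he, u, rfl⟩
      exact ⟨u, he, rfl⟩
    · rintro ⟨u, hu, rfl⟩
      exact ⟨hu, Sym2.mem_mk_left v u⟩
  rw [h, Set.ncard_image_of_injective _ fun _ _ => Sym2.congr_right.1]

theorem statement16 (k : ℕ) (hk : IsPrimePow k)
    (V : Type) [Fintype V] (G : SimpleGraph V) (hG : NoKDivisibleSubgraph k G) :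
    G.edgeSet.ncard ≤ (k - 1) * Fintype.card V := by
  classical
  by_contra! hlt
  rw [← Nat.card_coe_set_eq, Nat.card_eq_fintype_card] at hlt
  obtain ⟨S, ⟨e, he⟩, hS⟩ := exists_nonempty_forall_dvd_card_inter hk
    (fun v => Finset.univ.filter fun e : G.edgeSet => v ∈ (e : Sym2 V)) hlt
  set H := SimpleGraph.fromEdgeSet (Subtype.val '' (S : Set G.edgeSet)) with hH
  have hedge : H.edgeSet = Subtype.val '' (S : Set G.edgeSet) := by
    rw [hH, SimpleGraph.edgeSet_fromEdgeSet, sdiff_eq_left, Set.disjoint_left]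
    rintro _ ⟨x, -, rfl⟩
    exact G.not_isDiag_of_mem_edgeSet x.2
  have hbot : H = ⊥ := by
    refine hG H ?_ fun v => ?_
    · rw [← SimpleGraph.edgeSet_subset_edgeSet, hedge]
      rintro _ ⟨x, -, rfl⟩
      exact x.2
    · convert hS v using 1
      rw [H.ncard_setOf_adj_eq_ncard_edgeSet, ← Set.ncard_coe_finset,
        ← Set.ncard_image_of_injective _ Subtype.val_injective, hedge]
      congr 1
      ext x
      simp [and_comm, and_assoc]
  have : (e : Sym2 V) ∈ H.edgeSet := hedge ▸ ⟨e, he, rfl⟩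
  simp [hbot] at this
end
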